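/- arXiv:math-ph/0602039 — 3 statements merged into one kernel-verified Lean document; each statement's English description precedes it below -/
import Mathlib

section
/- Let N ≥ 2 and let μ_N be the Haar probability measure on the unitary group U(N). Then for all a, b ∈ ℂ, ∫_{U(N)} Per(a·1_N − U) · conj( Per(b·1_N − U) ) dμ_N(U) = (N−1) · ∫_0^1 (1−t)^{N−2} · (a·b̄ + t)^N dt. -/
open MeasureTheory Matrix Finset

instance matMS {m n : Type*} {α : Type*} [MeasurableSpace α] : MeasurableSpace (Matrix m n α) :=
  inferInstanceAs (MeasurableSpace (m → n → α))

/-- The permanent of a square complex matrix. -/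
noncomputable def perm {ι : Type*} [Fintype ι] [DecidableEq ι] (M : Matrix ι ι ℂ) : ℂ :=
  ∑ σ : Equiv.Perm ι, ∏ i, M i (σ i)

section PermanentMoments

open MvPolynomial

/-- The exponent vector of the squarefree monomial supported on `S`. -/
noncomputable def sqfree {n : Type*} (S : Finset n) : n →₀ ℕ := ∑ j ∈ S, Finsupp.single j 1

theorem sqfree_apply {n : Type*} [DecidableEq n] (S : Finset n) (j : n) :
    sqfree S j = if j ∈ S then 1 else 0 := by
  simp [sqfree, Finsupp.finsetSum_apply, Finsupp.single_apply]

section Fischer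
variable {n R : Type*} [Fintype n] [CommRing R]

/-- The bilinear Fischer (apolar) pairing `⟨F, G⟩ = ∑ α, α! F_α G_α` on polynomials. -/
noncomputable def fischer (F G : MvPolynomial n R) : R :=
  (basisMonomials n R).constr R (fun α => (∏ j, ((α j).factorial : R)) * coeff α G) F

theorem fischer_monomial (α : n →₀ ℕ) (c : R) (G : MvPolynomial n R) :
    fischer (monomial α c) G = c * ((∏ j, ((α j).factorial : R)) * coeff α G) := by
  have h : monomial α c = c • basisMonomials n R α := by simp [smul_monomial]
  rw [fischer, h, map_smul, Module.Basis.constr_basis, smul_eq_mul]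

theorem fischer_add_left (F F' G : MvPolynomial n R) :
    fischer (F + F') G = fischer F G + fischer F' G := map_add _ _ _

theorem fischer_sum_left {ι : Type*} (s : Finset ι) (F : ι → MvPolynomial n R)
    (G : MvPolynomial n R) : fischer (∑ i ∈ s, F i) G = ∑ i ∈ s, fischer (F i) G :=
  map_sum _ _ _

theorem fischer_C_mul_left (c : R) (F G : MvPolynomial n R) :
    fischer (C c * F) G = c * fischer F G := by
  rw [C_mul', fischer, map_smul, smul_eq_mul, fischer]

theorem fischer_sum_right {ι : Type*} (s : Finset ι) (F : MvPolynomial n R)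
    (G : ι → MvPolynomial n R) : fischer F (∑ i ∈ s, G i) = ∑ i ∈ s, fischer F (G i) := by
  induction F using MvPolynomial.induction_on' with
  | monomial α c => simp only [fischer_monomial, coeff_sum, mul_sum]
  | add p q hp hq => simp only [fischer_add_left, hp, hq, sum_add_distrib]

theorem fischer_C_mul_right (c : R) (F G : MvPolynomial n R) :
    fischer F (C c * G) = c * fischer F G := by
  induction F using MvPolynomial.induction_on' with
  | monomial α c => simp only [fischer_monomial, coeff_C_mul]; ring
  | add p q hp hq => simp only [fischer_add_left, hp, hq, mul_add]

theorem fischer_eq_sum {F : MvPolynomial n R} (G : MvPolynomial n R) {s : Finset (n →₀ ℕ)}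
    (hs : F.support ⊆ s) :
    fischer F G = ∑ α ∈ s, (∏ j, ((α j).factorial : R)) * (coeff α F * coeff α G) := by
  conv_lhs => rw [F.as_sum, fischer_sum_left]
  rw [sum_subset hs]
  · exact sum_congr rfl fun α _ => by rw [fischer_monomial]; ring
  · intro α _ h
    rw [notMem_support_iff.mp h, fischer_monomial, zero_mul]

/-- Multiplication by a variable is adjoint to partial differentiation. -/
theorem fischer_X_mul (j : n) (F G : MvPolynomial n R) :
    fischer (X j * F) G = fischer F (pderiv j G) := by
  induction F using MvPolynomial.induction_on' with
  | monomial α c =>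
    classical
    have h : ∏ i, (((α + Finsupp.single j 1 : n →₀ ℕ) i).factorial : R)
        = (∏ i, ((α i).factorial : R)) * (α j + 1) := by
      rw [← mul_prod_erase univ _ (mem_univ j),
        ← mul_prod_erase univ (fun i => ((α i).factorial : R)) (mem_univ j),
        prod_congr rfl (g := fun i => ((α i).factorial : R))]
      · simp [Nat.factorial_succ]; ring
      · intro i hi
        simp [Finsupp.single_eq_of_ne (ne_of_mem_erase hi)]
    rw [X, mul_comm, monomial_mul, mul_one, fischer_monomial, fischer_monomial, coeff_pderiv, h]
    ring
  | add p q hp hq => rw [mul_add, fischer_add_left, hp, hq, fischer_add_left]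

/-- The linear form in the variables whose coefficients are the `i`-th column of `A`. -/
noncomputable def colForm (A : Matrix n n R) (i : n) : MvPolynomial n R :=
  ∑ j, C (A j i) * X j

/-- The product of the linear forms attached to the columns of `A` indexed by `S`. -/
noncomputable def colProd (A : Matrix n n R) (S : Finset n) : MvPolynomial n R :=
  ∏ i ∈ S, colForm A i

/-- The derivation adjoint to multiplication by `colForm A i`. -/
noncomputable def colDeriv (A : Matrix n n R) (i : n) :
    Derivation R (MvPolynomial n R) (MvPolynomial n R) :=
  ∑ j, A j i • pderiv j

theorem colDeriv_apply (A : Matrix n n R) (i : n) (F : MvPolynomial n R) :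
    colDeriv A i F = ∑ j, C (A j i) * pderiv j F := by
  have h := congrFun (map_sum Derivation.coeFnAddMonoidHom (fun j => A j i • pderiv j) univ) F
  simp only [Derivation.coeFnAddMonoidHom, AddMonoidHom.coe_mk, ZeroHom.coe_mk,
    Finset.sum_apply, Derivation.smul_apply, smul_eq_C_mul] at h
  exact h

theorem fischer_colForm_mul (A : Matrix n n R) (i : n) (F G : MvPolynomial n R) :
    fischer (colForm A i * F) G = fischer F (colDeriv A i G) := by
  simp only [colForm, sum_mul, fischer_sum_left, mul_assoc, fischer_C_mul_left, fischer_X_mul,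
    colDeriv_apply, fischer_sum_right, fischer_C_mul_right]

theorem colProd_isHomogeneous (A : Matrix n n R) (S : Finset n) :
    (colProd A S).IsHomogeneous #S := by
  have h := IsHomogeneous.prod S (colForm A) (fun _ => 1) fun i _ =>
    IsHomogeneous.sum univ _ 1 fun j _ => isHomogeneous_C_mul_X (A j i) j
  simpa [colProd] using h

theorem eval_colProd_mul (V A : Matrix n n R) (S : Finset n) (x : n → R) :
    eval x (colProd (V * A) S) = eval (x ᵥ* V) (colProd A S) := by
  simp only [colProd, colForm, map_prod, map_sum, map_mul, eval_C, eval_X, Matrix.mul_apply,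
    Matrix.vecMul, dotProduct]
  refine prod_congr rfl fun i _ => ?_
  simp only [sum_mul, mul_sum]
  rw [sum_comm]
  exact sum_congr rfl fun j _ => sum_congr rfl fun k _ => by ring

variable [DecidableEq n]

theorem colDeriv_colForm (A B : Matrix n n R) (i k : n) :
    colDeriv A i (colForm B k) = C ((Aᵀ * B) i k) := by
  have h (j : n) : pderiv j (colForm B k) = C (B j k) := by
    simp [colForm, pderiv_X, Pi.single_apply]
  simp [colDeriv_apply, h, Matrix.mul_apply]

theorem fischer_colProd {A B : Matrix n n R} (h : Aᵀ * B = 1) (S : Finset n) :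
    fischer (colProd A S) (colProd B S) = 1 := by
  induction S using Finset.induction_on with
  | empty =>
    rw [colProd, colProd, prod_empty, prod_empty, ← C_1, C_apply, fischer_monomial]
    simp
  | insert a S ha ih =>
    have hD : colDeriv A a (colProd B S) = 0 := by
      have (T : Finset n) (hT : a ∉ T) : colDeriv A a (colProd B T) = 0 := by
        induction T using Finset.induction_on with
        | empty => simp [colProd]
        | insert b T hb ihT =>
          rw [colProd, prod_insert hb, Derivation.leibniz, colDeriv_colForm, h,
            Matrix.one_apply_ne (by rintro rfl; simp at hT)]
          simp only [colProd] at ihT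
          rw [ihT (fun h' => hT (mem_insert_of_mem h'))]
          simp
      exact this S ha
    rw [colProd, prod_insert ha, fischer_colForm_mul, colProd, prod_insert ha, Derivation.leibniz,
      colDeriv_colForm, h]
    simp only [colProd] at hD ih
    rw [hD, smul_zero, zero_add, Matrix.one_apply_eq, C_1, smul_eq_mul, mul_one, ih]

theorem support_colProd_subset (A : Matrix n n R) (S : Finset n) :
    (colProd A S).support ⊆ finsuppAntidiag univ #S := by
  intro α hα
  rw [mem_finsuppAntidiag, ← Finsupp.degree_eq_sum]
  refine ⟨?_, subset_univ _⟩
  by_contra h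
  exact mem_support_iff.mp hα ((colProd_isHomogeneous A S).coeff_eq_zero h)

theorem coeff_colProd_diagonal_mul (v : n → R) (A : Matrix n n R) (S : Finset n) (α : n →₀ ℕ) :
    coeff α (colProd (Matrix.diagonal v * A) S) = (∏ j, v j ^ α j) * coeff α (colProd A S) := by
  have h1 : colProd (Matrix.diagonal v * A) S
      = aeval (fun j => C (v j) * X j : n → MvPolynomial n R) (colProd A S) := by
    simp only [colProd, colForm, map_prod, map_sum, map_mul, aeval_X, Matrix.diagonal_mul]
    refine prod_congr rfl fun i _ => sum_congr rfl fun j _ => ?_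
    rw [← algebraMap_eq, AlgHom.commutes]
    ring
  have h2 (F : MvPolynomial n R) :
      coeff α (aeval (fun j => C (v j) * X j : n → MvPolynomial n R) F)
        = (∏ j, v j ^ α j) * coeff α F := by
    induction F using MvPolynomial.induction_on' with
    | monomial β c =>
      have : aeval (fun j => C (v j) * X j : n → MvPolynomial n R) (monomial β c)
          = monomial β (c * ∏ j, v j ^ β j) := by
        rw [aeval_monomial, Finsupp.prod_fintype _ _ (by simp), monomial_eq,
          Finsupp.prod_fintype _ _ (by simp)]
        simp only [mul_pow, prod_mul_distrib, algebraMap_eq, map_mul, map_prod, map_pow]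
        ring
      rw [this, coeff_monomial, coeff_monomial]
      split_ifs with hβ
      · rw [hβ, mul_comm]
      · simp
    | add p q hp hq => rw [map_add, coeff_add, hp, hq, coeff_add, mul_add]
  rw [h1, h2]

theorem coeff_sum_X_pow_mul_factorial {k : ℕ} {α : n →₀ ℕ} (hα : α ∈ finsuppAntidiag univ k) :
    (∏ j, ((α j).factorial : R)) * coeff α ((∑ j, X j : MvPolynomial n R) ^ k)
      = k.factorial := by
  rw [mem_finsuppAntidiag'] at hα
  rw [coeff_sum_X_pow_of_fintype, if_pos hα.1, ← Nat.cast_prod, ← Nat.cast_mul]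
  rw [Finsupp.multinomial_eq_of_support_subset hα.2, Nat.multinomial_spec, ← hα.1,
    Finsupp.sum_fintype _ _ (by simp)]

theorem coeff_colProd_univ (A : Matrix n n ℂ) : coeff (sqfree univ) (colProd A univ) = perm A := by
  have h (f : n → n) : ∏ i, C (A (f i) i) * X (f i)
      = monomial (∑ i, Finsupp.single (f i) 1) (∏ i, A (f i) i) := by
    rw [monomial_sum_index, map_prod, ← prod_mul_distrib]
    rfl
  have hp : perm A = ∑ σ : Equiv.Perm n, ∏ i, A (σ i) i := by
    refine Fintype.sum_equiv (Equiv.inv _) _ _ fun σ => ?_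
    exact Fintype.prod_equiv σ _ _ fun i => by simp
  simp only [colProd, colForm, Fintype.prod_sum, h, coeff_sum, coeff_monomial]
  rw [hp]
  symm
  refine sum_of_injOn (fun σ : Equiv.Perm n => (σ : n → n)) DFunLike.coe_injective.injOn
    (fun _ _ => by simp) ?_ ?_
  · intro f _ hf
    refine if_neg fun hsum => hf ?_
    have hsurj : Function.Surjective f := by
      intro j
      by_contra! hj
      have := DFunLike.congr_fun hsum j
      simp [sqfree_apply, Finsupp.finsetSum_apply, hj] at this
    exact ⟨Equiv.ofBijective f (Finite.surjective_iff_bijective.mp hsurj), by simp, rfl⟩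
  · intro σ _
    exact (if_pos (Equiv.sum_comp σ fun j => Finsupp.single j 1)).symm

theorem perm_smul_one_sub (a : ℂ) (A : Matrix n n ℂ) :
    perm (a • (1 : Matrix n n ℂ) - A)
      = ∑ S : Finset n, (-1) ^ #S * a ^ (Fintype.card n - #S) * coeff (sqfree S) (colProd A S) := by
  have h : colProd (a • (1 : Matrix n n ℂ) - A) univ
      = ∑ S : Finset n, C ((-1) ^ #S * a ^ (Fintype.card n - #S)) *
          (monomial (sqfree (univ \ S)) 1 * colProd A S) := by
    have hc (i : n) : colForm (a • (1 : Matrix n n ℂ) - A) i = C a * X i - colForm A i := by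
      simp [colForm, sub_mul, Matrix.one_apply, apply_ite C, ite_mul]
    simp only [colProd, hc, prod_sub, powerset_univ]
    refine sum_congr rfl fun S _ => ?_
    rw [sqfree, monomial_sum_one, prod_mul_distrib, prod_const, card_sdiff_of_subset (subset_univ S)]
    simp only [card_univ, map_mul, map_pow, map_neg, map_one, X]
    ring
  rw [← coeff_colProd_univ, h, coeff_sum]
  refine sum_congr rfl fun S _ => ?_
  have hs : sqfree (univ : Finset n) = sqfree (univ \ S) + sqfree S :=
    (sum_sdiff (subset_univ S)).symm
  rw [coeff_C_mul, hs, coeff_monomial_mul, one_mul]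

end Fischer

theorem colProd_map {n : Type*} [Fintype n] {R R' : Type*} [CommRing R] [CommRing R']
    (f : R →+* R') (A : Matrix n n R)
    (S : Finset n) : colProd (A.map f) S = MvPolynomial.map f (colProd A S) := by
  simp [colProd, colForm]

theorem eval_smul_colProd {n : Type*} [Fintype n] {R : Type*} [CommRing R]
    (A : Matrix n n R) (S : Finset n) (t : R)
    (x : n → R) : eval (t • x) (colProd A S) = t ^ #S * eval x (colProd A S) := by
  simp only [colProd, colForm, map_prod, map_sum, map_mul, eval_C, eval_X, Pi.smul_apply,
    smul_eq_mul, mul_left_comm _ t, ← mul_sum, prod_mul_distrib, prod_const]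

section Haar
variable {n : Type*} [Fintype n] [DecidableEq n]

/-- Real vectors of equal length are related by a Householder reflection. -/
theorem exists_unitary_vecMul_eq (x y : n → ℝ) (h : x ⬝ᵥ x = y ⬝ᵥ y) :
    ∃ V : Matrix.unitaryGroup n ℂ,
      (fun i => (x i : ℂ)) ᵥ* (V : Matrix n n ℂ) = fun i => (y i : ℂ) := by
  by_cases hxy : x = y
  · exact ⟨1, by simp [hxy]⟩
  set w := x - y with hw
  have hd : w ⬝ᵥ w ≠ 0 := by
    rw [Ne, dotProduct_self_eq_zero]
    exact sub_ne_zero.mpr hxy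
  set H : Matrix n n ℝ := 1 - (2 / (w ⬝ᵥ w)) • vecMulVec w w with hH
  have hHT : Hᵀ = H := by
    ext i j
    simp [hH, vecMulVec_apply, Matrix.one_apply, eq_comm, mul_comm]
  have hHH : H * H = 1 := by
    have h2 : vecMulVec w w * vecMulVec w w = (w ⬝ᵥ w) • vecMulVec w w := by
      rw [vecMulVec_mul_vecMulVec, vecMulVec_smul]
    rw [hH, sub_mul, mul_sub, mul_sub, one_mul, one_mul, mul_one, smul_mul_smul_comm, h2, smul_smul]
    have : 2 / (w ⬝ᵥ w) * (2 / (w ⬝ᵥ w)) * (w ⬝ᵥ w) = 2 * (2 / (w ⬝ᵥ w)) := by field_simp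
    rw [this, mul_smul, two_smul]
    abel
  have hxH : x ᵥ* H = y := by
    have h3 : w ⬝ᵥ w = 2 * (x ⬝ᵥ w) := by
      simp only [hw, dotProduct_sub, sub_dotProduct, dotProduct_comm y x]
      linarith
    have h4 : x ᵥ* vecMulVec w w = (x ⬝ᵥ w) • w := by
      ext i
      simp [Matrix.vecMul, vecMulVec_apply, dotProduct, sum_mul, mul_assoc]
    rw [hH, vecMul_sub, vecMul_one, vecMul_smul, h4, smul_smul]
    have : 2 / (w ⬝ᵥ w) * (x ⬝ᵥ w) = 1 := by
      rw [div_mul_eq_mul_div, ← h3, div_self hd]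
    rw [this, one_smul, hw, sub_sub_cancel]
  refine ⟨⟨H.map Complex.ofRealHom, ?_⟩, ?_⟩
  · rw [mem_unitaryGroup_iff]
    have : star (H.map Complex.ofRealHom) = H.map Complex.ofRealHom := by
      conv_rhs => rw [← hHT]
      ext i j
      simp [Matrix.star_apply]
    rw [this, ← Matrix.map_mul, hHH]
    simp
  · ext i
    have := congrArg Complex.ofRealHom (congrFun hxH i)
    rw [RingHom.map_vecMul] at this
    exact this

theorem measurable_unitaryGroup_entry (i j : n) :
    Measurable fun U : Matrix.unitaryGroup n ℂ => (U : Matrix n n ℂ) i j :=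
  (measurable_pi_apply j).comp ((measurable_pi_apply i).comp measurable_subtype_coe)

theorem measurable_unitaryGroup_mul_left (V : Matrix.unitaryGroup n ℂ) :
    Measurable fun U : Matrix.unitaryGroup n ℂ => V * U := by
  refine Measurable.subtype_mk (measurable_pi_iff.mpr fun i => measurable_pi_iff.mpr fun j => ?_)
  simp only [Matrix.mul_apply]
  exact Finset.measurable_sum _ fun k _ => (measurable_unitaryGroup_entry k j).const_mul _

theorem measurable_eval_colProd (S : Finset n) (x : n → ℂ) :
    Measurable fun U : Matrix.unitaryGroup n ℂ => eval x (colProd (U : Matrix n n ℂ) S) := by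
  simp only [colProd, colForm, map_prod, map_sum, map_mul, eval_C, eval_X]
  exact Finset.measurable_prod _ fun i _ => Finset.measurable_sum _ fun j _ =>
    (measurable_unitaryGroup_entry j i).mul_const _

/-- The coefficient of `x ^ α` in the product of the column forms of a unitary matrix. -/
noncomputable def colCoeff (S : Finset n) (α : n →₀ ℕ) (U : Matrix.unitaryGroup n ℂ) : ℂ :=
  coeff α (colProd (U : Matrix n n ℂ) S)

theorem measurable_colCoeff (S : Finset n) (α : n →₀ ℕ) : Measurable (colCoeff S α) := by
  unfold colCoeff colProd
  induction S using Finset.induction_on generalizing α with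
  | empty => simp
  | insert a S ha ih =>
    simp only [prod_insert ha, coeff_mul]
    refine Finset.measurable_sum _ fun p _ => Measurable.mul ?_ (ih _)
    simp only [colForm, coeff_sum, coeff_C_mul]
    exact Finset.measurable_sum _ fun j _ => (measurable_unitaryGroup_entry j a).mul_const _

theorem sum_factorial_mul_colCoeff (S : Finset n) (U : Matrix.unitaryGroup n ℂ) :
    ∑ α ∈ finsuppAntidiag univ #S, (∏ j, ((α j).factorial : ℂ)) *
      (colCoeff S α U * starRingEnd ℂ (colCoeff S α U)) = 1 := by
  have h : (U : Matrix n n ℂ)ᵀ * (U : Matrix n n ℂ).map (starRingEnd ℂ) = 1 := by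
    have := congrArg Matrix.transpose (mem_unitaryGroup_iff'.mp U.2)
    rw [Matrix.transpose_mul, Matrix.transpose_one] at this
    exact this
  have := fischer_colProd h S
  rw [fischer_eq_sum _ (support_colProd_subset _ S), colProd_map] at this
  simp only [coeff_map] at this
  exact this

theorem colCoeff_eq_zero {S : Finset n} {α : n →₀ ℕ} (hα : α ∉ finsuppAntidiag univ #S)
    (U : Matrix.unitaryGroup n ℂ) : colCoeff S α U = 0 :=
  notMem_support_iff.mp fun h => hα (support_colProd_subset _ S h)

theorem norm_colCoeff_le_one (S : Finset n) (α : n →₀ ℕ) (U : Matrix.unitaryGroup n ℂ) :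
    ‖colCoeff S α U‖ ≤ 1 := by
  by_cases hα : α ∈ finsuppAntidiag univ #S
  · have h := sum_factorial_mul_colCoeff S U
    simp only [Complex.mul_conj, Complex.normSq_eq_norm_sq] at h
    have h' : ∑ α ∈ finsuppAntidiag univ #S, (∏ j, ((α j).factorial : ℝ)) *
        ‖colCoeff S α U‖ ^ 2 = 1 := by exact_mod_cast h
    have h1 := single_le_sum (f := fun α => (∏ j, ((α j).factorial : ℝ)) * ‖colCoeff S α U‖ ^ 2)
      (fun β _ => by positivity) hα
    have h2 : (1 : ℝ) ≤ ∏ j, ((α j).factorial : ℝ) := by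
      exact_mod_cast Nat.succ_le_of_lt (prod_pos fun j _ => Nat.factorial_pos (α j))
    rw [h'] at h1
    have h3 : ‖colCoeff S α U‖ ^ 2 ≤ 1 := (le_mul_of_one_le_left (sq_nonneg _) h2).trans h1
    exact (sq_le_one_iff₀ (norm_nonneg _)).mp h3
  · simp [colCoeff_eq_zero hα]

variable (μ : Measure (Matrix.unitaryGroup n ℂ))

theorem integrable_colCoeff_mul_conj [IsFiniteMeasure μ] (S T : Finset n) (α β : n →₀ ℕ) :
    Integrable (fun U => colCoeff S α U * starRingEnd ℂ (colCoeff T β U)) μ := by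
  refine Integrable.of_bound (C := 1) ((measurable_colCoeff S α).mul
    (Complex.continuous_conj.measurable.comp (measurable_colCoeff T β))).aestronglyMeasurable
    (Filter.Eventually.of_forall fun U => ?_)
  rw [norm_mul, RCLike.norm_conj]
  exact mul_le_one₀ (norm_colCoeff_le_one S α U) (norm_nonneg _) (norm_colCoeff_le_one T β U)

theorem colCoeff_diagonal_mul (v : n → ℂ) (V U : Matrix.unitaryGroup n ℂ)
    (hV : (V : Matrix n n ℂ) = Matrix.diagonal v) (S : Finset n) (α : n →₀ ℕ) :
    colCoeff S α (V * U) = (∏ j, v j ^ α j) * colCoeff S α U := by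
  rw [colCoeff, UnitaryGroup.mul_val, hV, coeff_colProd_diagonal_mul, colCoeff]

theorem diagonal_mulSingle_mem_unitaryGroup (i : n) {z : ℂ} (hz : z * starRingEnd ℂ z = 1) :
    Matrix.diagonal (Pi.mulSingle i z) ∈ Matrix.unitaryGroup n ℂ := by
  rw [mem_unitaryGroup_iff, Matrix.star_eq_conjTranspose, diagonal_conjTranspose,
    diagonal_mul_diagonal, ← diagonal_one]
  congr 1
  ext j
  rcases eq_or_ne j i with rfl | hj
  · simpa using hz
  · simp [hj]

section Invariant
variable {μ} (hμ : ∀ V : Matrix.unitaryGroup n ℂ, μ.map (fun U => V * U) = μ)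
include hμ

theorem integral_unitaryGroup_mul_left {f : Matrix.unitaryGroup n ℂ → ℂ} (hf : Measurable f)
    (V : Matrix.unitaryGroup n ℂ) : ∫ U, f (V * U) ∂μ = ∫ U, f U ∂μ := by
  conv_rhs => rw [← hμ V]
  rw [integral_map (measurable_unitaryGroup_mul_left V).aemeasurable hf.aestronglyMeasurable]

theorem integral_colCoeff_mul_conj_of_ne (S T : Finset n) {α β : n →₀ ℕ} (hαβ : α ≠ β) :
    ∫ U, colCoeff S α U * starRingEnd ℂ (colCoeff T β U) ∂μ = 0 := by
  obtain ⟨i, hi⟩ : ∃ i, α i ≠ β i := by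
    by_contra! h
    exact hαβ (Finsupp.ext h)
  have hm : α i + β i + 1 ≠ 0 := by omega
  have hz := Complex.isPrimitiveRoot_exp _ hm
  set z := Complex.exp (2 * Real.pi * Complex.I / ((α i + β i + 1 : ℕ) : ℂ))
  have hz1 : z * starRingEnd ℂ z = 1 := by
    rw [Complex.mul_conj, Complex.normSq_eq_norm_sq, hz.norm'_eq_one hm]
    simp
  have hw : z ^ α i * starRingEnd ℂ (z ^ β i) ≠ 1 := by
    intro h
    refine hi (hz.pow_inj (by omega) (by omega) ?_)
    have hb : starRingEnd ℂ (z ^ β i) * z ^ β i = 1 := by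
      rw [map_pow, ← mul_pow, mul_comm, hz1, one_pow]
    calc z ^ α i = z ^ α i * (starRingEnd ℂ (z ^ β i) * z ^ β i) := by rw [hb, mul_one]
      _ = z ^ β i := by rw [← mul_assoc, h, one_mul]
  have hprod (γ : n →₀ ℕ) : ∏ j, (Pi.mulSingle i z : n → ℂ) j ^ γ j = z ^ γ i := by
    rw [prod_eq_single i (fun j _ hj => by simp [hj]) (by simp), Pi.mulSingle_eq_same]
  have h := integral_unitaryGroup_mul_left hμ (f := fun U =>
    colCoeff S α U * starRingEnd ℂ (colCoeff T β U)) ((measurable_colCoeff S α).mul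
    (Complex.continuous_conj.measurable.comp (measurable_colCoeff T β)))
    ⟨_, diagonal_mulSingle_mem_unitaryGroup i hz1⟩
  simp only [colCoeff_diagonal_mul (Pi.mulSingle i z)
    ⟨_, diagonal_mulSingle_mem_unitaryGroup i hz1⟩ _ rfl, hprod, map_mul,
    mul_mul_mul_comm _ _ (starRingEnd ℂ (z ^ β i)), integral_const_mul] at h
  by_contra h0
  exact hw (mul_right_cancel₀ h0 (h.trans (one_mul _).symm))

variable [IsProbabilityMeasure μ]

theorem integral_eval_colProd_mul_conj (S : Finset n) (x : n → ℂ) :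
    ∫ U : Matrix.unitaryGroup n ℂ, eval x (colProd (U : Matrix n n ℂ) S) *
        starRingEnd ℂ (eval x (colProd (U : Matrix n n ℂ) S)) ∂μ
      = ∑ α ∈ finsuppAntidiag univ #S, (∫ U, colCoeff S α U * starRingEnd ℂ (colCoeff S α U) ∂μ) *
          ∏ j, (x j * starRingEnd ℂ (x j)) ^ α j := by
  have h1 (U : Matrix.unitaryGroup n ℂ) : eval x (colProd (U : Matrix n n ℂ) S)
      = ∑ α ∈ finsuppAntidiag univ #S, colCoeff S α U * ∏ j, x j ^ α j := by
    rw [eval_eq']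
    exact sum_subset (support_colProd_subset _ S) fun α _ h => by
      rw [notMem_support_iff.mp h, zero_mul]
  have h2 (U : Matrix.unitaryGroup n ℂ) : eval x (colProd (U : Matrix n n ℂ) S) *
        starRingEnd ℂ (eval x (colProd (U : Matrix n n ℂ) S))
      = ∑ α ∈ finsuppAntidiag univ #S, ∑ β ∈ finsuppAntidiag univ #S,
        (∏ j, x j ^ α j) * starRingEnd ℂ (∏ j, x j ^ β j) *
          (colCoeff S α U * starRingEnd ℂ (colCoeff S β U)) := by
    rw [h1, map_sum, sum_mul_sum]
    exact sum_congr rfl fun α _ => sum_congr rfl fun β _ => by rw [map_mul]; ring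
  simp only [h2]
  rw [integral_finsetSum _ fun α _ => integrable_finsetSum _ fun β _ =>
    (integrable_colCoeff_mul_conj μ S S α β).const_mul _]
  refine sum_congr rfl fun α hα => ?_
  rw [integral_finsetSum _ fun β _ => (integrable_colCoeff_mul_conj μ S S α β).const_mul _,
    sum_eq_single α]
  · rw [integral_const_mul, mul_comm, map_prod, ← prod_mul_distrib]
    simp only [mul_pow, map_pow]
  · intro β _ hβ
    rw [integral_const_mul, integral_colCoeff_mul_conj_of_ne hμ S S hβ.symm, mul_zero]
  · exact fun h => absurd hα h

theorem integral_normSq_colCoeff_mul_factorial [Nonempty n] (S : Finset n) :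
    ∃ c : ℂ, ∀ α ∈ finsuppAntidiag univ #S,
      (∏ j, ((α j).factorial : ℂ)) * ∫ U, colCoeff S α U * starRingEnd ℂ (colCoeff S α U) ∂μ
        = c := by
  obtain ⟨i⟩ := ‹Nonempty n›
  set m : (n →₀ ℕ) → ℂ := fun α => ∫ U, colCoeff S α U * starRingEnd ℂ (colCoeff S α U) ∂μ
  set c₀ : ℂ := ∫ U : Matrix.unitaryGroup n ℂ,
    eval (Pi.single i 1) (colProd (U : Matrix n n ℂ) S) *
      starRingEnd ℂ (eval (Pi.single i 1) (colProd (U : Matrix n n ℂ) S)) ∂μ with hc₀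
  have key : ∑ α ∈ finsuppAntidiag univ #S, monomial α (m α)
      = C c₀ * (∑ j, X j : MvPolynomial n ℂ) ^ #S := by
    refine funext_set (fun _ => Complex.ofReal '' Set.Ici 0)
      (fun _ => (Set.Ici_infinite 0).image Complex.ofReal_injective.injOn) fun r hr => ?_
    choose ρ hρ0 hρ using fun j => hr j (Set.mem_univ j)
    set t : ℝ := √(∑ j, ρ j)
    have ht : t * t = ∑ j, ρ j := Real.mul_self_sqrt (sum_nonneg fun j _ => hρ0 j)
    have hsq (j : n) : √(ρ j) * √(ρ j) = ρ j := Real.mul_self_sqrt (hρ0 j)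
    obtain ⟨V, hV⟩ := exists_unitary_vecMul_eq (fun j => √(ρ j)) (t • Pi.single i 1) (by
      rw [smul_dotProduct, dotProduct_smul, single_one_dotProduct, Pi.single_eq_same, smul_eq_mul,
        smul_eq_mul, mul_one, ht]
      exact sum_congr rfl fun j _ => hsq j)
    have hV' : (fun j => ((√(ρ j) : ℝ) : ℂ)) ᵥ* (V : Matrix n n ℂ)
        = (t : ℂ) • (Pi.single i 1 : n → ℂ) := by
      rw [hV]
      ext j
      rcases eq_or_ne j i with rfl | hj
      · simp
      · simp [hj]
    have h1 := integral_eval_colProd_mul_conj hμ S (fun j => ((√(ρ j) : ℝ) : ℂ))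
    rw [← integral_unitaryGroup_mul_left hμ (f := fun U => eval _ (colProd (U : Matrix n n ℂ) S) *
      starRingEnd ℂ (eval _ (colProd (U : Matrix n n ℂ) S))) ((measurable_eval_colProd S _).mul
      (Complex.continuous_conj.measurable.comp (measurable_eval_colProd S _))) V] at h1
    simp only [UnitaryGroup.mul_val, eval_colProd_mul, hV', eval_smul_colProd, map_mul,
      map_pow, Complex.conj_ofReal, mul_mul_mul_comm _ _ ((t : ℂ) ^ #S), integral_const_mul, ← hc₀,
      ← mul_pow,
      ← Complex.ofReal_mul, ht, hsq] at h1
    simp only [map_sum, map_mul, map_pow, eval_C, eval_X, eval_monomial, ← hρ]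
    rw [mul_comm c₀, ← Complex.ofReal_sum, h1]
    refine sum_congr rfl fun α _ => ?_
    rw [Finsupp.prod_fintype _ _ (by simp)]
  refine ⟨c₀ * (#S).factorial, fun α hα => ?_⟩
  have h := congrArg (coeff α) key
  simp only [coeff_sum, coeff_monomial, sum_ite_eq', hα, if_true, coeff_C_mul] at h
  change _ * m α = _
  rw [h, mul_left_comm, coeff_sum_X_pow_mul_factorial hα]

theorem integral_normSq_colCoeff_sqfree [Nonempty n] (S : Finset n) :
    ∫ U, colCoeff S (sqfree S) U * starRingEnd ℂ (colCoeff S (sqfree S) U) ∂μ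
      = ((Fintype.card n).multichoose #S : ℂ)⁻¹ := by
  obtain ⟨c, hc⟩ := integral_normSq_colCoeff_mul_factorial hμ S
  have hmem : sqfree S ∈ finsuppAntidiag univ #S := by
    simp [mem_finsuppAntidiag, sqfree_apply]
  have h1 := hc _ hmem
  have hf : ∏ j, ((sqfree S j).factorial : ℂ) = 1 :=
    prod_eq_one fun j _ => by rw [sqfree_apply]; split_ifs <;> simp
  rw [hf, one_mul] at h1
  rw [h1]
  have h2 : ∑ α ∈ finsuppAntidiag univ #S, (∏ j, ((α j).factorial : ℂ)) *
      ∫ U, colCoeff S α U * starRingEnd ℂ (colCoeff S α U) ∂μ = 1 := by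
    simp only [← integral_const_mul]
    rw [← integral_finsetSum _ fun α _ => (integrable_colCoeff_mul_conj μ S S α α).const_mul _]
    simp only [sum_factorial_mul_colCoeff]
    simp
  rw [sum_congr rfl hc, sum_const, card_finsuppAntidiag_nat_eq_multichoose, card_univ,
    nsmul_eq_mul] at h2
  exact eq_inv_of_mul_eq_one_right h2

theorem integral_perm_mul_conj_perm [Nonempty n] (a b : ℂ) :
    ∫ U : Matrix.unitaryGroup n ℂ, perm (a • (1 : Matrix n n ℂ) - (U : Matrix n n ℂ)) *
        starRingEnd ℂ (perm (b • (1 : Matrix n n ℂ) - (U : Matrix n n ℂ))) ∂μ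
      = ∑ S : Finset n, (a * starRingEnd ℂ b) ^ (Fintype.card n - #S) *
          ((Fintype.card n).multichoose #S : ℂ)⁻¹ := by
  have h (U : Matrix.unitaryGroup n ℂ) :
      perm (a • (1 : Matrix n n ℂ) - (U : Matrix n n ℂ)) *
        starRingEnd ℂ (perm (b • (1 : Matrix n n ℂ) - (U : Matrix n n ℂ)))
      = ∑ S : Finset n, ∑ T : Finset n,
        (((-1) ^ #S * a ^ (Fintype.card n - #S)) *
          starRingEnd ℂ ((-1) ^ #T * b ^ (Fintype.card n - #T))) *
          (colCoeff S (sqfree S) U * starRingEnd ℂ (colCoeff T (sqfree T) U)) := by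
    rw [perm_smul_one_sub, perm_smul_one_sub, map_sum, sum_mul_sum]
    exact sum_congr rfl fun S _ => sum_congr rfl fun T _ => by
      rw [map_mul, colCoeff, colCoeff]; ring
  simp only [h]
  rw [integral_finsetSum _ fun S _ => integrable_finsetSum _ fun T _ =>
    (integrable_colCoeff_mul_conj μ S T _ _).const_mul _]
  refine sum_congr rfl fun S _ => ?_
  rw [integral_finsetSum _ fun T _ => (integrable_colCoeff_mul_conj μ S T _ _).const_mul _,
    sum_eq_single S]
  · rw [integral_const_mul, integral_normSq_colCoeff_sqfree hμ S]
    congr 1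
    have h1 : ((-1 : ℂ) ^ #S) * (-1) ^ #S = 1 := by rw [← mul_pow]; simp
    simp only [map_mul, map_pow, map_neg, map_one, mul_pow]
    linear_combination (a ^ (Fintype.card n - #S) * starRingEnd ℂ b ^ (Fintype.card n - #S)) * h1
  · intro T _ hT
    rw [integral_const_mul, integral_colCoeff_mul_conj_of_ne hμ S T, mul_zero]
    intro hST
    refine hT (Finset.ext fun j => ?_)
    have := DFunLike.congr_fun hST j
    rw [sqfree_apply, sqfree_apply] at this
    by_cases hS : j ∈ S <;> by_cases hT' : j ∈ T <;> simp_all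
  · exact fun h => absurd (mem_univ S) h

end Invariant

end Haar

theorem integral_one_sub_pow_mul_pow (m k : ℕ) :
    ((m : ℂ) + 1) * ∫ t in (0 : ℝ)..1, ((1 - t : ℝ) : ℂ) ^ m * (t : ℂ) ^ k
      = ((m + 2).multichoose k : ℂ)⁻¹ := by
  have h := Complex.betaIntegral_eval_nat_add_one_right (u := (k : ℂ) + 1)
    (by simp; positivity) m
  rw [Complex.betaIntegral] at h
  simp only [add_sub_cancel_right, Complex.cpow_natCast] at h
  have hI : ∫ t in (0 : ℝ)..1, ((1 - t : ℝ) : ℂ) ^ m * (t : ℂ) ^ k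
      = ∫ t in (0 : ℝ)..1, (t : ℂ) ^ k * (1 - (t : ℂ)) ^ m :=
    intervalIntegral.integral_congr fun t _ => by push_cast; ring
  have hP : ∏ j ∈ range (m + 1), ((k : ℂ) + 1 + j)
      = (m + 1).factorial * ((m + 2).multichoose k : ℂ) := by
    have h1 : (m + 2).multichoose k = (k + (m + 1)).choose (m + 1) := by
      rw [Nat.multichoose_eq, Nat.choose_symm_add.symm]
      congr 1
      omega
    have h2 := Nat.ascFactorial_eq_factorial_mul_choose k (m + 1)
    rw [Nat.ascFactorial_eq_prod_range] at h2
    rw [h1]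
    exact_mod_cast h2
  have hf : (m.factorial : ℂ) ≠ 0 := by exact_mod_cast m.factorial_ne_zero
  have hm : (m : ℂ) + 1 ≠ 0 := by exact_mod_cast m.succ_ne_zero
  rw [hI, h, hP, Nat.factorial_succ]
  push_cast
  field_simp

theorem integral_one_sub_pow_mul_add_pow (m : ℕ) (c : ℂ) (n : Type*) [Fintype n] :
    ((m : ℂ) + 1) * ∫ t in (0 : ℝ)..1, ((1 - t : ℝ) : ℂ) ^ m * (c + (t : ℂ)) ^ Fintype.card n
      = ∑ S : Finset n, c ^ (Fintype.card n - #S) * ((m + 2).multichoose #S : ℂ)⁻¹ := by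
  have h (t : ℝ) : ((1 - t : ℝ) : ℂ) ^ m * (c + (t : ℂ)) ^ Fintype.card n
      = ∑ S : Finset n, c ^ (Fintype.card n - #S) * (((1 - t : ℝ) : ℂ) ^ m * (t : ℂ) ^ #S) := by
    rw [add_comm c, ← Fintype.sum_pow_mul_eq_add_pow, mul_sum]
    exact sum_congr rfl fun S _ => by ring
  simp only [h]
  rw [intervalIntegral.integral_finsetSum fun S _ =>
    Continuous.intervalIntegrable (by fun_prop) _ _, mul_sum]
  refine sum_congr rfl fun S _ => ?_
  rw [intervalIntegral.integral_const_mul, mul_left_comm, integral_one_sub_pow_mul_pow]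

end PermanentMoments

/-- Integral form of the two-point correlation function of CUE permanental polynomials:
for `N ≥ 2` and the Haar probability measure on `U(N)`,
`∫ Per(a·1-U) conj(Per(b·1-U)) dμ_N(U) = (N-1) ∫_0^1 (1-t)^{N-2} (a b̄ + t)^N dt`. -/
theorem cue_two_point_correlation_integral_form (N : ℕ) (hN : 2 ≤ N) (a b : ℂ)
    (μH : Measure (Matrix.unitaryGroup (Fin N) ℂ)) [IsProbabilityMeasure μH]
    (hinv : ∀ V : Matrix.unitaryGroup (Fin N) ℂ, μH.map (fun U => V * U) = μH) :
    (∫ U : Matrix.unitaryGroup (Fin N) ℂ,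
        perm (a • (1 : Matrix (Fin N) (Fin N) ℂ) - (U : Matrix (Fin N) (Fin N) ℂ)) *
        (starRingEnd ℂ)
          (perm (b • (1 : Matrix (Fin N) (Fin N) ℂ) - (U : Matrix (Fin N) (Fin N) ℂ))) ∂μH)
      = ((N : ℂ) - 1) *
          ∫ t in (0 : ℝ)..1, ((1 - t : ℝ) : ℂ) ^ (N - 2) *
            (a * (starRingEnd ℂ) b + (t : ℂ)) ^ N := by
  have : Nonempty (Fin N) := ⟨⟨0, by omega⟩⟩
  rw [integral_perm_mul_conj_perm hinv]
  obtain ⟨m, rfl⟩ := Nat.exists_eq_add_of_le' hN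
  have h := integral_one_sub_pow_mul_add_pow m (a * starRingEnd ℂ b) (Fin (m + 2))
  simp only [Fintype.card_fin] at h ⊢
  rw [← h]
  push_cast
  ring
end

section
/- Let N ≥ 1, n ≥ 1, and μ_1^{(A)},…,μ_n^{(A)}, μ_1^{(B)},…,μ_n^{(B)} ∈ ℂ. Set M_A = diag(μ_1^{(A)},…,μ_n^{(A)}) and M_B = diag( conj(μ_1^{(B)}),…, conj(μ_n^{(B)}) ). Let γ_Gin^{(N)} be the complex Ginibre probability measure on N×N complex matrices, and let γ^{(n,N)} be the probability measure on n×n complex matrices Q with density (N/π)^{n²}·exp(−N·Tr(Q* Q)) with respect to Lebesgue measure in the coordinates (Re Q_{ij}, Im Q_{ij}). Then ∫ ∏_{k=1}^n Per(μ_k^{(A)}·1_N − Z) · conj( Per(μ_k^{(B)}·1_N − Z) ) dγ_Gin^{(N)}(Z) = ∫ [ Per( [[M_A, Q*],[Q, M_B]] ) ]^N dγ^{(n,N)}(Q), where [[M_A, Q*],[Q, M_B]] denotes the 2n×2n block matrix with diagonal blocks M_A, M_B and off-diagonal blocks Q* (upper right) and Q (lower left). -/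
open MeasureTheory Matrix Finset

/-- The complex matrix built from real coordinates `(Re Z_ij, Im Z_ij)`. -/
noncomputable def matOf (m : ℕ) (x : Fin m × Fin m → ℝ × ℝ) : Matrix (Fin m) (Fin m) ℂ :=
  fun i j => ((x (i, j)).1 : ℂ) + ((x (i, j)).2 : ℂ) * Complex.I

/-- The Ginibre-type probability measure on `m × m` complex matrices with density
`(N/π)^{m²} exp(-N Σ_{ij} |Z_ij|²) = (N/π)^{m²} exp(-N Tr(Z* Z))` with respect to
Lebesgue measure in the coordinates `(Re Z_ij, Im Z_ij)`.  For `m = N` this is the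
complex Ginibre ensemble. -/
noncomputable def ginibre (N m : ℕ) : Measure (Matrix (Fin m) (Fin m) ℂ) :=
  Measure.map (matOf m) (volume.withDensity fun x =>
    ENNReal.ofReal (((N : ℝ) / Real.pi) ^ (m ^ 2) *
      Real.exp (-(N : ℝ) * ∑ p : Fin m × Fin m, ((x p).1 ^ 2 + (x p).2 ^ 2))))

section Permanents

variable {ι κ : Type*} [Fintype ι] [DecidableEq ι] [Fintype κ] [DecidableEq κ]

theorem perm_submatrix_equiv (e : ι ≃ κ) (M : Matrix κ κ ℂ) :
    perm (M.submatrix e e) = perm M := by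
  unfold perm
  refine Fintype.sum_equiv e.permCongr _ _ fun σ => ?_
  refine Fintype.prod_equiv e _ _ fun i => ?_
  simp

theorem perm_blockDiagonal (M : κ → Matrix ι ι ℂ) :
    perm (blockDiagonal M) = ∏ k, perm (M k) := by
  unfold perm
  rw [Finset.prod_univ_sum, Fintype.piFinset_univ]
  symm
  refine Fintype.sum_of_injective (fun σ : κ → Equiv.Perm ι => Equiv.prodCongrLeft σ) ?_ _ _ ?_ ?_
  · intro σ τ h
    funext k
    ext i
    simpa using congrArg Prod.fst (DFunLike.congr_fun h (i, k))
  · intro σ hσ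
    by_contra hne
    have hsnd : ∀ x, (σ x).2 = x.2 := by
      intro x
      by_contra hx
      refine hne (Finset.prod_eq_zero (Finset.mem_univ x) ?_)
      obtain ⟨i, k⟩ := x
      rw [blockDiagonal_apply, if_neg fun h => hx h.symm]
    have hsnd' : ∀ x, (σ.symm x).2 = x.2 := fun x => by
      simpa [eq_comm] using hsnd (σ.symm x)
    have h1 : ∀ i k, ((σ (i, k)).1, k) = σ (i, k) := fun i k => Prod.ext rfl (hsnd (i, k)).symm
    have h2 : ∀ i k, ((σ.symm (i, k)).1, k) = σ.symm (i, k) :=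
      fun i k => Prod.ext rfl (hsnd' (i, k)).symm
    refine hσ ⟨fun k => ⟨fun i => (σ (i, k)).1, fun i => (σ.symm (i, k)).1, ?_, ?_⟩, ?_⟩
    · intro i
      simp [h1]
    · intro i
      simp [h2]
    · ext ⟨i, k⟩ <;> simp [hsnd]
  · intro σ
    rw [← Finset.univ_product_univ, Finset.prod_product_right]
    simp [blockDiagonal_apply]

theorem perm_diagonal_add (d : ι → ℂ) (M : Matrix ι ι ℂ) :
    perm (diagonal d + M) =
      ∑ S : Finset ι, (∏ i ∈ Sᶜ, d i) * perm (M.submatrix (Subtype.val : S → ι) Subtype.val) := by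
  have expand : ∀ σ : Equiv.Perm ι, ∏ i, (diagonal d + M) i (σ i) =
      ∑ S : Finset ι, (∏ i ∈ S, M i (σ i)) * ∏ i ∈ Sᶜ, diagonal d i (σ i) := by
    intro σ
    simp only [Matrix.add_apply, add_comm (diagonal d _ _)]
    rw [Finset.prod_add, Finset.powerset_univ]
    rfl
  unfold perm
  rw [Finset.sum_congr rfl fun σ _ => expand σ, Finset.sum_comm]
  refine Finset.sum_congr rfl fun S _ => ?_
  rw [Finset.mul_sum]
  symm
  refine Fintype.sum_of_injective (fun σ : Equiv.Perm S => Equiv.Perm.ofSubtype σ)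
    Equiv.Perm.ofSubtype_injective _ _ ?_ ?_
  · intro σ hσ
    by_contra hne
    have hfix : ∀ i, i ∉ S → σ i = i := by
      intro i hi
      by_contra hx
      refine hne (mul_eq_zero_of_right _ (Finset.prod_eq_zero (Finset.mem_compl.2 hi) ?_))
      exact diagonal_apply_ne' _ hx
    refine hσ ⟨(Equiv.Perm.subtypeEquivSubtypePerm (· ∈ S)).symm ⟨σ, hfix⟩, ?_⟩
    exact congrArg Subtype.val
      ((Equiv.Perm.subtypeEquivSubtypePerm (· ∈ S)).apply_symm_apply ⟨σ, hfix⟩)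
  · intro σ
    rw [mul_comm]
    congr 1
    · rw [← Finset.prod_coe_sort S]
      refine Finset.prod_congr rfl fun i _ => ?_
      simp
    · refine Finset.prod_congr rfl fun i hi => ?_
      rw [Equiv.Perm.ofSubtype_apply_of_not_mem _ (Finset.mem_compl.1 hi), diagonal_apply_eq]

theorem perm_fromBlocks_zero_diag (X : Matrix ι κ ℂ) (Y : Matrix κ ι ℂ) :
    perm (fromBlocks 0 X Y 0) = (∑ β : ι ≃ κ, ∏ s, X s (β s)) * ∑ γ : κ ≃ ι, ∏ t, Y t (γ t) := by
  unfold perm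
  rw [Finset.sum_mul_sum, ← Fintype.sum_prod_type']
  symm
  refine Fintype.sum_of_injective
    (fun p : (ι ≃ κ) × (κ ≃ ι) => (Equiv.sumCongr p.1 p.2).trans (Equiv.sumComm κ ι)) ?_ _ _ ?_ ?_
  · rintro ⟨β, γ⟩ ⟨β', γ'⟩ h
    refine Prod.ext (Equiv.ext fun s => ?_) (Equiv.ext fun t => ?_)
    · simpa using DFunLike.congr_fun h (Sum.inl s)
    · simpa using DFunLike.congr_fun h (Sum.inr t)
  · intro σ hσ
    by_contra hne
    have hl : ∀ s, ∃ t, σ (Sum.inl s) = Sum.inr t := by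
      intro s
      rcases h : σ (Sum.inl s) with x | x
      · exact absurd (Finset.prod_eq_zero (Finset.mem_univ (Sum.inl s)) (by simp [h])) hne
      · exact ⟨x, rfl⟩
    have hr : ∀ t, ∃ s, σ (Sum.inr t) = Sum.inl s := by
      intro t
      rcases h : σ (Sum.inr t) with x | x
      · exact ⟨x, rfl⟩
      · exact absurd (Finset.prod_eq_zero (Finset.mem_univ (Sum.inr t)) (by simp [h])) hne
    choose f hf using hl
    choose g hg using hr
    have finj : Function.Injective f := fun a b hab => by
      have : σ (Sum.inl a) = σ (Sum.inl b) := by rw [hf, hf, hab]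
      simpa using this
    have ginj : Function.Injective g := fun a b hab => by
      have : σ (Sum.inr a) = σ (Sum.inr b) := by rw [hg, hg, hab]
      simpa using this
    have hcard : Fintype.card ι = Fintype.card κ :=
      le_antisymm (Fintype.card_le_of_injective f finj) (Fintype.card_le_of_injective g ginj)
    refine hσ ⟨(Equiv.ofBijective f ((Fintype.bijective_iff_injective_and_card f).2 ⟨finj, hcard⟩),
      Equiv.ofBijective g ((Fintype.bijective_iff_injective_and_card g).2 ⟨ginj, hcard.symm⟩)), ?_⟩
    ext (s | t)
    · simp [hf]
    · simp [hg]
  · rintro ⟨β, γ⟩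
    simp [Fintype.prod_sum_type]

theorem perm_fromBlocks_diagonal (a : ι → ℂ) (b : κ → ℂ) (X : Matrix ι κ ℂ) (Y : Matrix κ ι ℂ) :
    perm (fromBlocks (diagonal a) X Y (diagonal b)) =
      ∑ S : Finset ι, ∑ T : Finset κ, ((∏ i ∈ Sᶜ, a i) * ∏ j ∈ Tᶜ, b j) *
        ((∑ β : S ≃ T, ∏ s : S, X s (β s)) * ∑ γ : T ≃ S, ∏ t : T, Y t (γ t)) := by
  have hsplit : fromBlocks (diagonal a) X Y (diagonal b) =
      diagonal (Sum.elim a b) + fromBlocks 0 X Y 0 := by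
    rw [← fromBlocks_diagonal, fromBlocks_add]
    simp
  rw [hsplit, perm_diagonal_add, ← Fintype.sum_prod_type']
  refine (Fintype.sum_equiv (Finset.sumEquiv (α := ι) (β := κ)).symm.toEquiv _ _ ?_).symm
  rintro ⟨S, T⟩
  change _ = (∏ i ∈ (S.disjSum T)ᶜ, Sum.elim a b i) *
    perm ((fromBlocks 0 X Y 0).submatrix (Subtype.val : S.disjSum T → ι ⊕ κ) Subtype.val)
  symm
  congr 1
  · have : (S.disjSum T)ᶜ = Sᶜ.disjSum Tᶜ := by
      ext (x | x) <;> simp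
    rw [this, Finset.prod_disjSum]
    simp
  · rw [← perm_fromBlocks_zero_diag (fun (s : S) (t : T) => X s t) fun (t : T) (s : S) => Y t s]
    let e : S ⊕ T ≃ (S.disjSum T : Finset (ι ⊕ κ)) :=
      { toFun := Sum.elim (fun s => ⟨Sum.inl s, by simp⟩) fun t => ⟨Sum.inr t, by simp⟩
        invFun := fun u => match u with
          | ⟨Sum.inl s, h⟩ => Sum.inl ⟨s, by simpa using h⟩
          | ⟨Sum.inr t, h⟩ => Sum.inr ⟨t, by simpa using h⟩
        left_inv := by rintro (s | t) <;> rfl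
        right_inv := by rintro ⟨s | t, h⟩ <;> rfl }
    rw [← perm_submatrix_equiv e]
    congr 1
    ext (s | t) (s' | t') <;> rfl

end Permanents

section Gaussian

open scoped Nat ComplexConjugate

theorem sum_equiv_prod_ite {S T P : Type*} [Fintype S] [DecidableEq S] [Fintype T] [DecidableEq T]
    [Fintype P] [DecidableEq P] (p : S → P) (q : T → P) (c : ℂ) :
    ∑ θ : S ≃ T, ∏ s, (if p s = q (θ s) then c else 0) =
      ∏ x, if Fintype.card {s // p s = x} = Fintype.card {t // q t = x} then
        ((Fintype.card {s // p s = x})! : ℂ) * c ^ Fintype.card {s // p s = x} else 0 := by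
  by_cases h : ∀ x, Fintype.card {s // p s = x} = Fintype.card {t // q t = x}
  · let θ₀ : S ≃ T := Equiv.ofFiberEquiv fun x => Fintype.equivOfCardEq (h x)
    have hθ₀ : ∀ s, q (θ₀ s) = p s := fun s => Equiv.ofFiberEquiv_map _ s
    have hsum : ∑ θ : S ≃ T, ∏ s, (if p s = q (θ s) then c else 0) =
        ∑ g : Equiv.Perm S, if p ∘ g = p then c ^ Fintype.card S else 0 := by
      refine (Fintype.sum_equiv (Equiv.equivCongr (Equiv.refl S) θ₀) _ _ fun g => ?_).symm
      rw [Finset.prod_ite_zero]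
      simp [hθ₀, funext_iff, eq_comm]
    rw [hsum, ← Finset.sum_filter, Finset.sum_const, ← Fintype.card_subtype,
      DomMulAct.stabilizer_card]
    simp only [h, if_true, Finset.prod_mul_distrib, Finset.prod_pow_eq_pow_sum]
    simp only [← h, ← Fintype.card_sigma, Fintype.card_congr (Equiv.sigmaFiberEquiv p)]
    simp
  · obtain ⟨x, hx⟩ := not_forall.1 h
    rw [Finset.prod_eq_zero (Finset.mem_univ x) (if_neg hx)]
    refine Finset.sum_eq_zero fun θ _ => ?_
    rw [Finset.prod_ite_zero, if_neg]
    intro hθ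
    exact hx (Fintype.card_congr (θ.subtypeEquiv fun s => by rw [hθ s (Finset.mem_univ s)]))

theorem integrable_pow_mul_exp_neg_mul_sq {N : ℝ} (hN : 0 < N) (a b : ℕ) :
    Integrable fun z : ℂ => (N / Real.pi * Real.exp (-N * ‖z‖ ^ 2) : ℝ) * (z ^ a * conj z ^ b) := by
  have hint : Integrable fun z : ℂ => ‖z‖ ^ ((a + b : ℕ) : ℝ) * Real.exp (-N * ‖z‖ ^ (2 : ℝ)) := by
    refine Integrable.of_integral_ne_zero ?_
    rw [Complex.integral_rpow_mul_exp_neg_mul_rpow (by norm_num)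
      (lt_of_lt_of_le (by norm_num) (Nat.cast_nonneg _)) hN]
    have : 0 < Real.Gamma ((((a + b : ℕ) : ℝ) + 2) / 2) := Real.Gamma_pos_of_pos (by positivity)
    positivity
  refine (hint.const_mul (N / Real.pi)).mono' (by fun_prop) (Filter.Eventually.of_forall fun z => ?_)
  simp only [norm_mul, norm_pow, Complex.norm_real, RCLike.norm_conj, Real.rpow_natCast,
    Real.rpow_ofNat, Real.norm_eq_abs, Real.abs_exp, abs_of_pos hN, abs_of_pos Real.pi_pos, abs_div]
  rw [pow_add]
  exact le_of_eq (by ring)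

theorem integral_pow_mul_exp_neg_mul_sq {N : ℝ} (hN : 0 < N) (a b : ℕ) :
    ∫ z : ℂ, (N / Real.pi * Real.exp (-N * ‖z‖ ^ 2) : ℝ) * (z ^ a * conj z ^ b) =
      if a = b then (a ! : ℂ) * ((1 / N : ℝ) : ℂ) ^ a else 0 := by
  split_ifs with hab
  · subst hab
    have h := Complex.integral_rpow_mul_exp_neg_mul_rpow (p := 2) (q := ((2 * a : ℕ) : ℝ)) (b := N)
      (by norm_num) (lt_of_lt_of_le (by norm_num) (Nat.cast_nonneg _)) hN
    have hpt : ∀ z : ℂ, ((N / Real.pi * Real.exp (-N * ‖z‖ ^ 2) : ℝ) : ℂ) * (z ^ a * conj z ^ a) =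
        ((N / Real.pi * (‖z‖ ^ ((2 * a : ℕ) : ℝ) * Real.exp (-N * ‖z‖ ^ (2 : ℝ))) : ℝ) : ℂ) := by
      intro z
      rw [← mul_pow, Complex.mul_conj, Complex.normSq_eq_norm_sq, Real.rpow_natCast, pow_mul,
        Real.rpow_ofNat]
      push_cast
      ring
    have hexp : (((2 * a : ℕ) : ℝ) + 2) / 2 = (a : ℝ) + 1 := by push_cast; ring
    have hexp' : -(((2 * a : ℕ) : ℝ) + 2) / 2 = -((a + 1 : ℕ) : ℝ) := by push_cast; ring
    simp_rw [hpt]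
    rw [integral_complex_ofReal, integral_const_mul, h, hexp, hexp', Real.Gamma_nat_eq_factorial,
      Real.rpow_neg hN.le, Real.rpow_natCast]
    have := Real.pi_pos.ne'
    have := hN.ne'
    have : N ^ a ≠ 0 := pow_ne_zero a hN.ne'
    rw [← Complex.ofReal_natCast, ← Complex.ofReal_pow, ← Complex.ofReal_mul]
    congr 1
    rw [pow_succ, one_div, inv_pow]
    field_simp
  · obtain ⟨u, hne⟩ : ∃ u : Circle, (u : ℂ) ^ a * conj (u : ℂ) ^ b ≠ 1 := by
      refine ⟨Circle.exp (Real.pi / ((a : ℝ) - b)), fun h => Circle.exp_pi_ne_one ?_⟩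
      have hsub : (a : ℝ) - b ≠ 0 := sub_ne_zero.2 (by exact_mod_cast hab)
      rw [← Circle.coe_inv_eq_conj, ← Circle.coe_pow, ← Circle.coe_pow, ← Circle.coe_mul,
        Circle.coe_eq_one, inv_pow, ← div_eq_mul_inv, ← Circle.exp_natCast_mul,
        ← Circle.exp_natCast_mul, ← Circle.exp_sub, ← sub_mul, mul_div_cancel₀ _ hsub] at h
      exact h
    have hrot := (LinearIsometryEquiv.measurePreserving (rotation u)).integral_comp
      (rotation u).toHomeomorph.measurableEmbedding
      fun z : ℂ => ((N / Real.pi * Real.exp (-N * ‖z‖ ^ 2) : ℝ) : ℂ) * (z ^ a * conj z ^ b)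
    have hpt : ∀ z : ℂ, ((N / Real.pi * Real.exp (-N * ‖rotation u z‖ ^ 2) : ℝ) : ℂ) *
        (rotation u z ^ a * conj (rotation u z) ^ b) = ((u : ℂ) ^ a * conj (u : ℂ) ^ b) *
        (((N / Real.pi * Real.exp (-N * ‖z‖ ^ 2) : ℝ) : ℂ) * (z ^ a * conj z ^ b)) := by
      intro z
      rw [LinearIsometryEquiv.norm_map, rotation_apply, map_mul, mul_pow, mul_pow]
      ring
    simp_rw [hpt] at hrot
    rw [integral_const_mul] at hrot
    rw [← sub_eq_zero, ← sub_one_mul] at hrot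
    exact (mul_eq_zero.1 hrot).resolve_left (sub_ne_zero.2 hne)

theorem integrable_and_integral_gaussian_coordinates {N : ℝ} (hN : 0 < N) (a b : ℕ) :
    Integrable (fun x : ℝ × ℝ => ((N / Real.pi * Real.exp (-N * (x.1 ^ 2 + x.2 ^ 2)) : ℝ) : ℂ) *
        (((x.1 : ℂ) + x.2 * Complex.I) ^ a * conj ((x.1 : ℂ) + x.2 * Complex.I) ^ b)) ∧
      ∫ x : ℝ × ℝ, ((N / Real.pi * Real.exp (-N * (x.1 ^ 2 + x.2 ^ 2)) : ℝ) : ℂ) *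
        (((x.1 : ℂ) + x.2 * Complex.I) ^ a * conj ((x.1 : ℂ) + x.2 * Complex.I) ^ b) =
      if a = b then (a ! : ℂ) * ((1 / N : ℝ) : ℂ) ^ a else 0 := by
  have hmp := Complex.volume_preserving_equiv_real_prod.symm
  have hemb := Complex.measurableEquivRealProd.symm.measurableEmbedding
  have hpt : (fun x : ℝ × ℝ => ((N / Real.pi * Real.exp (-N * (x.1 ^ 2 + x.2 ^ 2)) : ℝ) : ℂ) *
        (((x.1 : ℂ) + x.2 * Complex.I) ^ a * conj ((x.1 : ℂ) + x.2 * Complex.I) ^ b)) =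
      (fun z : ℂ => ((N / Real.pi * Real.exp (-N * ‖z‖ ^ 2) : ℝ) : ℂ) * (z ^ a * conj z ^ b)) ∘
        Complex.measurableEquivRealProd.symm := by
    funext x
    have hx : Complex.measurableEquivRealProd.symm x = (x.1 : ℂ) + x.2 * Complex.I :=
      Complex.mk_eq_add_mul_I x.1 x.2
    rw [Function.comp_apply, hx, ← Complex.normSq_eq_norm_sq, Complex.normSq_add_mul_I]
  rw [hpt]
  exact ⟨(hmp.integrable_comp_emb hemb).2 (integrable_pow_mul_exp_neg_mul_sq hN a b),
    (hmp.integral_comp hemb _).trans (integral_pow_mul_exp_neg_mul_sq hN a b)⟩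

/-- `f` is integrable with integral `v`. -/
def HasIntegralValue {Ω : Type*} [MeasurableSpace Ω] (μ : Measure Ω) (f : Ω → ℂ) (v : ℂ) : Prop :=
  Integrable f μ ∧ ∫ ω, f ω ∂μ = v

namespace HasIntegralValue

variable {Ω : Type*} [MeasurableSpace Ω] {μ : Measure Ω}

theorem const_mul {f : Ω → ℂ} {v : ℂ} (h : HasIntegralValue μ f v) (c : ℂ) :
    HasIntegralValue μ (fun ω => c * f ω) (c * v) :=
  ⟨h.1.const_mul c, by rw [integral_const_mul, h.2]⟩

theorem sum {ι : Type*} {s : Finset ι} {f : ι → Ω → ℂ} {v : ι → ℂ}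
    (h : ∀ i ∈ s, HasIntegralValue μ (f i) (v i)) :
    HasIntegralValue μ (fun ω => ∑ i ∈ s, f i ω) (∑ i ∈ s, v i) :=
  ⟨integrable_finsetSum s fun i hi => (h i hi).1, by
    rw [integral_finsetSum s fun i hi => (h i hi).1]
    exact Finset.sum_congr rfl fun i hi => (h i hi).2⟩

end HasIntegralValue

theorem measurable_matOf (m : ℕ) : Measurable (matOf m) := by
  refine measurable_pi_lambda _ fun i => measurable_pi_lambda _ fun j => ?_
  unfold matOf
  fun_prop

theorem measurable_matrix_entry {m : ℕ} (i j : Fin m) :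
    Measurable fun Z : Matrix (Fin m) (Fin m) ℂ => Z i j :=
  (measurable_pi_apply j).comp (measurable_pi_apply i)

theorem hasIntegralValue_ginibre_prod_pow {N : ℕ} (hN : 1 ≤ N) (m : ℕ)
    (a b : Fin m × Fin m → ℕ) :
    HasIntegralValue (ginibre N m)
      (fun Z => ∏ x, (Z x.1 x.2 ^ a x * conj (Z x.1 x.2) ^ b x))
      (∏ x, if a x = b x then ((a x)! : ℂ) * ((1 / N : ℝ) : ℂ) ^ a x else 0) := by
  have hN' : (0 : ℝ) < N := by exact_mod_cast hN
  have hmeas : Measurable fun Z : Matrix (Fin m) (Fin m) ℂ =>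
      ∏ x : Fin m × Fin m, (Z x.1 x.2 ^ a x * conj (Z x.1 x.2) ^ b x) := by
    refine Finset.measurable_prod _ fun x _ => ?_
    have h := measurable_matrix_entry x.1 x.2
    exact (h.pow_const _).mul ((Complex.continuous_conj.measurable.comp h).pow_const _)
  have hdens : Measurable fun x : Fin m × Fin m → ℝ × ℝ =>
      ENNReal.ofReal (((N : ℝ) / Real.pi) ^ (m ^ 2) *
        Real.exp (-(N : ℝ) * ∑ p : Fin m × Fin m, ((x p).1 ^ 2 + (x p).2 ^ 2))) := by
    fun_prop
  have hpt : ∀ x : Fin m × Fin m → ℝ × ℝ, (ENNReal.ofReal (((N : ℝ) / Real.pi) ^ (m ^ 2) *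
        Real.exp (-(N : ℝ) * ∑ p : Fin m × Fin m, ((x p).1 ^ 2 + (x p).2 ^ 2)))).toReal •
        (∏ p : Fin m × Fin m, (matOf m x p.1 p.2 ^ a p * conj (matOf m x p.1 p.2) ^ b p)) =
      ∏ p, (((N / Real.pi * Real.exp (-N * ((x p).1 ^ 2 + (x p).2 ^ 2)) : ℝ) : ℂ) *
        ((((x p).1 : ℂ) + (x p).2 * Complex.I) ^ a p *
          conj (((x p).1 : ℂ) + (x p).2 * Complex.I) ^ b p)) := by
    intro x
    rw [ENNReal.toReal_ofReal (by positivity), Complex.real_smul]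
    conv_rhs =>
      rw [Finset.prod_mul_distrib, ← Complex.ofReal_prod, Finset.prod_mul_distrib,
        ← Real.exp_sum, ← Finset.mul_sum,
        Finset.prod_const, Finset.card_univ, Fintype.card_prod, Fintype.card_fin, ← sq]
    rfl
  have hone := fun p => integrable_and_integral_gaussian_coordinates hN' (a p) (b p)
  unfold HasIntegralValue ginibre
  rw [integrable_map_measure hmeas.aestronglyMeasurable (measurable_matOf m).aemeasurable,
    integral_map (measurable_matOf m).aemeasurable hmeas.aestronglyMeasurable,
    integrable_withDensity_iff_integrable_smul' hdens (by simp),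
    integral_withDensity_eq_integral_toReal_smul hdens (by simp)]
  simp only [Function.comp_apply, hpt]
  refine ⟨Integrable.fintype_prod (f := fun p (y : ℝ × ℝ) =>
    (((N / Real.pi * Real.exp (-N * (y.1 ^ 2 + y.2 ^ 2)) : ℝ) : ℂ) *
        (((y.1 : ℂ) + y.2 * Complex.I) ^ a p *
          conj ((y.1 : ℂ) + y.2 * Complex.I) ^ b p))) fun p => (hone p).1, ?_⟩
  rw [integral_fintype_prod_volume_eq_prod (fun p (y : ℝ × ℝ) =>
    (((N / Real.pi * Real.exp (-N * (y.1 ^ 2 + y.2 ^ 2)) : ℝ) : ℂ) *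
        (((y.1 : ℂ) + y.2 * Complex.I) ^ a p *
          conj ((y.1 : ℂ) + y.2 * Complex.I) ^ b p)))]
  exact Finset.prod_congr rfl fun p _ => (hone p).2

/-- Wick's formula for the Ginibre measure. -/
theorem hasIntegralValue_ginibre_monomial {N : ℕ} (hN : 1 ≤ N) {m : ℕ} {S T : Type*}
    [Fintype S] [DecidableEq S] [Fintype T] [DecidableEq T]
    (p : S → Fin m × Fin m) (q : T → Fin m × Fin m) :
    HasIntegralValue (ginibre N m)
      (fun Z => (∏ s, Z (p s).1 (p s).2) * ∏ t, conj (Z (q t).1 (q t).2))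
      (∑ θ : S ≃ T, ∏ s, if p s = q (θ s) then ((1 / N : ℝ) : ℂ) else 0) := by
  rw [sum_equiv_prod_ite]
  convert hasIntegralValue_ginibre_prod_pow hN m (fun x => Fintype.card {s // p s = x})
    fun x => Fintype.card {t // q t = x} using 2 with Z
  rw [Finset.prod_mul_distrib, ← Fintype.prod_fiberwise p, ← Fintype.prod_fiberwise q]
  congr 1
  all_goals
    refine Finset.prod_congr rfl fun x _ => ?_
    rw [Fintype.card, ← Finset.prod_const]
    exact Finset.prod_congr rfl fun s _ => by rw [s.2]

end Gaussian

section Duality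

open scoped ComplexConjugate

variable {S T : Type*} [Fintype S] [DecidableEq S] [Fintype T] [DecidableEq T]

theorem hasIntegralValue_ginibre_label_preserving_perms {N : ℕ} (hN : 1 ≤ N) {K : Type*}
    [DecidableEq K] (i : S → Fin N) (j : T → Fin N) (k : S → K) (l : T → K) :
    HasIntegralValue (ginibre N N)
      (fun Z => (∑ σ : Equiv.Perm S, ∏ s, if k s = k (σ s) then -Z (i s) (i (σ s)) else 0) *
        ∑ τ : Equiv.Perm T, ∏ t, if l t = l (τ t) then -conj (Z (j t) (j (τ t))) else 0)
      (∑ σ : Equiv.Perm S, ∑ τ : Equiv.Perm T, ∑ θ : S ≃ T,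
        if (∀ s, k s = k (σ s)) ∧ (∀ t, l t = l (τ t)) ∧
            ∀ s, i s = j (θ s) ∧ i (σ s) = j (τ (θ s)) then
          ((1 / N : ℝ) : ℂ) ^ Fintype.card S else 0) := by
  simp_rw [Finset.sum_mul_sum]
  refine HasIntegralValue.sum fun σ _ => HasIntegralValue.sum fun τ _ => ?_
  have h := (hasIntegralValue_ginibre_monomial hN (fun s => (i s, i (σ s)))
    fun t => (j t, j (τ t))).const_mul
      ((if ∀ s, k s = k (σ s) then (-1) ^ Fintype.card S else 0) *
        if ∀ t, l t = l (τ t) then (-1) ^ Fintype.card T else 0)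
  convert h using 1
  · funext Z
    rw [Finset.prod_ite_zero, Finset.prod_ite_zero, Finset.prod_neg, Finset.prod_neg]
    simp only [Finset.mem_univ, forall_const, Finset.card_univ]
    split_ifs <;> ring
  · rw [Finset.mul_sum]
    refine Finset.sum_congr rfl fun θ _ => ?_
    rw [Finset.prod_ite_zero, ← Fintype.card_congr θ]
    simp only [Finset.mem_univ, forall_const, Finset.prod_const, Finset.card_univ, Prod.mk.injEq]
    have hsign : ((-1 : ℂ) ^ Fintype.card S) * (-1) ^ Fintype.card S = 1 := by
      rw [← mul_pow]; simp
    split_ifs <;> first | tauto | simp [hsign]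

theorem hasIntegralValue_ginibre_label_preserving_matchings {N n : ℕ} (hN : 1 ≤ N) {I : Type*}
    [DecidableEq I] (i : S → I) (j : T → I) (k : S → Fin n) (l : T → Fin n) :
    HasIntegralValue (ginibre N n)
      (fun Q => (∑ β : S ≃ T, ∏ s, if i s = j (β s) then conj (Q (l (β s)) (k s)) else 0) *
        ∑ γ : T ≃ S, ∏ t, if j t = i (γ t) then Q (l t) (k (γ t)) else 0)
      (∑ β : S ≃ T, ∑ γ : T ≃ S, ∑ θ : T ≃ S,
        if (∀ s, i s = j (β s)) ∧ (∀ t, j t = i (γ t)) ∧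
            ∀ t, l t = l (β (θ t)) ∧ k (γ t) = k (θ t) then
          ((1 / N : ℝ) : ℂ) ^ Fintype.card S else 0) := by
  simp_rw [Finset.sum_mul_sum]
  refine HasIntegralValue.sum fun β _ => HasIntegralValue.sum fun γ _ => ?_
  have h := (hasIntegralValue_ginibre_monomial hN (fun t => (l t, k (γ t)))
    fun s => (l (β s), k s)).const_mul
      ((if ∀ s, i s = j (β s) then 1 else 0) * if ∀ t, j t = i (γ t) then 1 else 0)
  convert h using 1
  · funext Q
    rw [Finset.prod_ite_zero, Finset.prod_ite_zero]
    simp only [Finset.mem_univ, forall_const]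
    split_ifs <;> ring
  · rw [Finset.mul_sum]
    refine Finset.sum_congr rfl fun θ _ => ?_
    rw [Finset.prod_ite_zero, ← Fintype.card_congr θ]
    simp only [Finset.mem_univ, forall_const, Finset.prod_const, Finset.card_univ, Prod.mk.injEq]
    split_ifs <;> first | tauto | simp

/-- Pairs of permutations `σ`, `τ` with a matching `θ` correspond to triples of matchings
through `β = θ`, `θ' = (τ θ)⁻¹`, `γ = σ θ'`. -/
def permsMatchingEquiv (S T : Type*) :
    Equiv.Perm S × Equiv.Perm T × (S ≃ T) ≃ (S ≃ T) × (T ≃ S) × (T ≃ S) where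
  toFun x := (x.2.2, x.2.1.symm.trans (x.2.2.symm.trans x.1), x.2.1.symm.trans x.2.2.symm)
  invFun y := (y.2.2.symm.trans y.2.1, y.1.symm.trans y.2.2.symm, y.1)
  left_inv := by
    rintro ⟨σ, τ, θ⟩
    refine Prod.ext (Equiv.ext fun s => ?_) (Prod.ext (Equiv.ext fun t => ?_) rfl) <;> simp
  right_inv := by
    rintro ⟨β, γ, θ⟩
    refine Prod.ext rfl (Prod.ext (Equiv.ext fun s => ?_) (Equiv.ext fun t => ?_)) <;> simp

theorem sum_perms_matching_eq_sum_matchings {I K : Type*} [DecidableEq I] [DecidableEq K]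
    (i : S → I) (j : T → I) (k : S → K) (l : T → K) (c : ℂ) :
    (∑ σ : Equiv.Perm S, ∑ τ : Equiv.Perm T, ∑ θ : S ≃ T,
        if (∀ s, k s = k (σ s)) ∧ (∀ t, l t = l (τ t)) ∧
            ∀ s, i s = j (θ s) ∧ i (σ s) = j (τ (θ s)) then c else 0) =
      ∑ β : S ≃ T, ∑ γ : T ≃ S, ∑ θ : T ≃ S,
        if (∀ s, i s = j (β s)) ∧ (∀ t, j t = i (γ t)) ∧
            ∀ t, l t = l (β (θ t)) ∧ k (γ t) = k (θ t) then c else 0 := by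
  simp_rw [← Fintype.sum_prod_type']
  refine Fintype.sum_equiv (permsMatchingEquiv S T) _ _ ?_
  rintro ⟨σ, τ, θ⟩
  refine if_congr ?_ rfl rfl
  have hT : ∀ P : T → Prop, (∀ t, P t) ↔ ∀ s, P (τ (θ s)) := fun P =>
    (θ.trans τ).forall_congr_right.symm
  have hl : (∀ t, l t = l (τ t)) ↔ ∀ s, l (θ s) = l (τ (θ s)) := θ.forall_congr_right.symm
  rw [hl, forall_and, forall_and, hT, hT, hT]
  simp only [permsMatchingEquiv, Equiv.coe_fn_mk, Equiv.trans_apply, Equiv.symm_apply_apply,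
    eq_comm (a := k (σ _)), eq_comm (a := i (σ _)), eq_comm (a := l (τ _))]
  tauto

variable {N n : ℕ}

theorem prod_perm_smul_one_sub (μ : Fin n → ℂ) (Z : Matrix (Fin N) (Fin N) ℂ) :
    ∏ k, perm (μ k • (1 : Matrix (Fin N) (Fin N) ℂ) - Z) =
      ∑ S : Finset (Fin N × Fin n), (∏ x ∈ Sᶜ, μ x.2) *
        ∑ σ : Equiv.Perm S, ∏ s : S,
          if s.1.2 = (σ s).1.2 then -Z s.1.1 (σ s).1.1 else 0 := by
  rw [← perm_blockDiagonal]
  refine Eq.trans ?_ (perm_diagonal_add (fun x : Fin N × Fin n => μ x.2)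
    (of fun x y => if x.2 = y.2 then -Z x.1 y.1 else 0))
  congr 1
  ext ⟨a, k⟩ ⟨b, l⟩
  by_cases hk : k = l <;> by_cases ha : a = b <;>
    simp [blockDiagonal_apply, one_apply, hk, ha, sub_eq_add_neg]

theorem perm_fromBlocks_diagonal_pow (a b : Fin n → ℂ) (X Y : Matrix (Fin n) (Fin n) ℂ) :
    perm (fromBlocks (diagonal a) X Y (diagonal b)) ^ N =
      ∑ S : Finset (Fin N × Fin n), ∑ T : Finset (Fin N × Fin n),
        ((∏ x ∈ Sᶜ, a x.2) * ∏ x ∈ Tᶜ, b x.2) *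
        ((∑ β : S ≃ T, ∏ s : S, if s.1.1 = (β s).1.1 then X s.1.2 (β s).1.2 else 0) *
          ∑ γ : T ≃ S, ∏ t : T, if t.1.1 = (γ t).1.1 then Y t.1.2 (γ t).1.2 else 0) := by
  have hpow : perm (fromBlocks (diagonal a) X Y (diagonal b)) ^ N =
      perm (blockDiagonal fun _ : Fin N => fromBlocks (diagonal a) X Y (diagonal b)) := by
    rw [perm_blockDiagonal]
    simp
  let e : (Fin N × Fin n) ⊕ (Fin N × Fin n) ≃ (Fin n ⊕ Fin n) × Fin N :=
    (Equiv.sumCongr (Equiv.prodComm _ _) (Equiv.prodComm _ _)).trans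
      (Equiv.sumProdDistrib _ _ _).symm
  rw [hpow, ← perm_submatrix_equiv e]
  refine Eq.trans ?_ (perm_fromBlocks_diagonal (fun x : Fin N × Fin n => a x.2)
    (fun x : Fin N × Fin n => b x.2) (of fun x y => if x.1 = y.1 then X x.2 y.2 else 0)
    (of fun x y => if x.1 = y.1 then Y x.2 y.2 else 0))
  congr 1
  ext (⟨p, k⟩ | ⟨p, k⟩) (⟨q, l⟩ | ⟨q, l⟩) <;>
    by_cases hp : p = q <;> by_cases hk : k = l <;>
    simp [e, blockDiagonal_apply, hp, hk]

end Duality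

/-- Duality for the `2n`-point correlation function of Ginibre permanental polynomials:
`⟨∏_k Per(μ_k^{(A)}·1_N - Z) conj(Per(μ_k^{(B)}·1_N - Z))⟩_{Gin(N)}`
equals `∫ [Per([[M_A, Q*],[Q, M_B]])]^N dγ^{(n,N)}(Q)`, where `M_A = diag(μ^{(A)})`,
`M_B = diag(conj μ^{(B)})`, and `γ^{(n,N)}` is the Gaussian measure on `n × n` complex
matrices with density `(N/π)^{n²} exp(-N Tr(Q*Q))`. -/
theorem ginibre_correlation_duality (N n : ℕ) (hN : 1 ≤ N) (hn : 1 ≤ n)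
    (μA μB : Fin n → ℂ) :
    (∫ Z, (∏ k, perm (μA k • (1 : Matrix (Fin N) (Fin N) ℂ) - Z) *
        (starRingEnd ℂ) (perm (μB k • (1 : Matrix (Fin N) (Fin N) ℂ) - Z))) ∂(ginibre N N))
      = ∫ Q, (perm (Matrix.fromBlocks (Matrix.diagonal μA) Qᴴ Q
          (Matrix.diagonal fun k => (starRingEnd ℂ) (μB k)))) ^ N ∂(ginibre N n) := by
  let w : Finset (Fin N × Fin n) → Finset (Fin N × Fin n) → ℂ := fun S T =>
    (∏ x ∈ Sᶜ, μA x.2) * ∏ x ∈ Tᶜ, (starRingEnd ℂ) (μB x.2)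
  have left := HasIntegralValue.sum fun S (_ : S ∈ (univ : Finset (Finset (Fin N × Fin n)))) =>
    HasIntegralValue.sum fun T (_ : T ∈ (univ : Finset (Finset (Fin N × Fin n)))) =>
      (hasIntegralValue_ginibre_label_preserving_perms hN
        (fun s : S => s.1.1) (fun t : T => t.1.1) (fun s : S => s.1.2)
        fun t : T => t.1.2).const_mul (w S T)
  have right := HasIntegralValue.sum fun S (_ : S ∈ (univ : Finset (Finset (Fin N × Fin n)))) =>
    HasIntegralValue.sum fun T (_ : T ∈ (univ : Finset (Finset (Fin N × Fin n)))) =>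
      (hasIntegralValue_ginibre_label_preserving_matchings hN
        (fun s : S => s.1.1) (fun t : T => t.1.1) (fun s : S => s.1.2)
        fun t : T => t.1.2).const_mul (w S T)
  calc
    _ = _ := by
      refine integral_congr_ae (Filter.Eventually.of_forall fun Z => ?_)
      simp only [w]
      rw [Finset.prod_mul_distrib, ← map_prod, prod_perm_smul_one_sub, prod_perm_smul_one_sub,
        map_sum, Finset.sum_mul_sum]
      refine Finset.sum_congr rfl fun S _ => Finset.sum_congr rfl fun T _ => ?_
      simp only [map_mul, map_sum, map_prod, apply_ite (starRingEnd ℂ), map_neg, map_zero]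
      ring
    _ = _ := left.2
    _ = _ := by
      refine Finset.sum_congr rfl fun S _ => Finset.sum_congr rfl fun T _ => ?_
      exact congrArg (w S T * ·) (sum_perms_matching_eq_sum_matchings (fun s : S => s.1.1)
        (fun t : T => t.1.1) (fun s : S => s.1.2) (fun t : T => t.1.2) _)
    _ = _ := right.2.symm
    _ = _ := by
      refine integral_congr_ae (Filter.Eventually.of_forall fun Q => ?_)
      simp only [w]
      rw [perm_fromBlocks_diagonal_pow]
      rfl
end

section
/- Let N ≥ 1 and let γ_GOE be the GOE probability measure on N×N real symmetric matrices. Let π_N denote the monic orthogonal polynomial of degree N with respect to the weight e^{−N x²/2} on ℝ. Then for every μ ∈ ℂ, the expected GOE permanental polynomial satisfies ∫ Per(μ·1_N − H) dγ_GOE(H) = ( i^N / 2^{N/2} ) · π_N( −i·√2·μ ). -/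
open MeasureTheory Matrix Finset Polynomial

/-- The real symmetric matrix built from the coordinates: diagonal entries `x.1 i` and
off-diagonal entries `H_ij = H_ji = x.2 ⟨(i,j), _⟩` for `i < j`. -/
noncomputable def symOf (N : ℕ)
    (x : (Fin N → ℝ) × ({p : Fin N × Fin N // p.1 < p.2} → ℝ)) :
    Matrix (Fin N) (Fin N) ℝ := fun i j =>
  if h : i < j then x.2 ⟨(i, j), h⟩
  else if h' : j < i then x.2 ⟨(j, i), h'⟩
  else x.1 i

/-- The GOE probability measure on `N × N` real symmetric matrices with density
`2^{-N/2} (N/π)^{N(N+1)/4} exp(-(N/2) Tr H²)` with respect to Lebesgue measure in the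
coordinates `(H_ii)_i, (H_ij)_{i<j}`. -/
noncomputable def goe (N : ℕ) : Measure (Matrix (Fin N) (Fin N) ℝ) :=
  Measure.map (symOf N) (volume.withDensity fun x =>
    ENNReal.ofReal ((2 : ℝ) ^ (-(N : ℝ) / 2) * ((N : ℝ) / Real.pi) ^ ((N : ℝ) * (N + 1) / 4) *
      Real.exp (-(N : ℝ) / 2 * Matrix.trace (symOf N x ^ 2))))

/-- `p` is the monic orthogonal polynomial of degree `k` for the weight `w` on `ℝ`:
monic of degree `k` and orthogonal to all lower-degree polynomials. -/
def IsMonicOrthogonal (w : ℝ → ℝ) (k : ℕ) (p : Polynomial ℝ) : Prop :=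
  p.Monic ∧ p.natDegree = k ∧ ∀ j < k, ∫ x : ℝ, x ^ j * p.eval x * w x = 0

/-- The monic Hermite polynomials for the weight `exp (-a x ^ 2 / 2)`, defined by
`Q (n + 1) = x Q n - a⁻¹ (Q n)'`. -/
noncomputable def scaledHermite (a : ℝ) : ℕ → ℝ[X]
  | 0 => 1
  | n + 1 => X * scaledHermite a n - C a⁻¹ * derivative (scaledHermite a n)

lemma scaledHermite_eq_hermite_comp {s : ℝ} (hs : s ≠ 0) (n : ℕ) :
    scaledHermite (s ^ 2) n =
      C (s⁻¹ ^ n) * ((hermite n).map (Int.castRingHom ℝ)).comp (C s * X) := by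
  induction n with
  | zero => simp [scaledHermite]
  | succ n ih =>
    have h1 : (C s⁻¹ * C s : ℝ[X]) = 1 := by rw [← C_mul, inv_mul_cancel₀ hs, C_1]
    have h2 : (C (s ^ 2)⁻¹ : ℝ[X]) = C s⁻¹ ^ 2 := by rw [← C_pow, inv_pow]
    rw [scaledHermite, ih, hermite_succ, h2, pow_succ s⁻¹]
    simp only [Polynomial.map_sub, Polynomial.map_mul, map_X, sub_comp, mul_comp, X_comp,
      derivative_mul, derivative_C, derivative_comp, derivative_X, derivative_map,
      map_mul, zero_mul, mul_one, zero_add]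
    linear_combination (C (s⁻¹ ^ n) * ((hermite n).map (Int.castRingHom ℝ)).comp (C s * X) * X
      * (-1 : ℝ[X])
      + -C (s⁻¹ ^ n) * C s⁻¹ *
        ((derivative (hermite n)).map (Int.castRingHom ℝ)).comp (C s * X)) * h1

lemma scaledHermite_monic_natDegree {a : ℝ} (ha : 0 < a) (n : ℕ) :
    (scaledHermite a n).Monic ∧ (scaledHermite a n).natDegree = n := by
  obtain ⟨s, hs, rfl⟩ : ∃ s : ℝ, 0 < s ∧ s ^ 2 = a :=
    ⟨√a, Real.sqrt_pos.2 ha, Real.sq_sqrt ha.le⟩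
  have hd : (scaledHermite (s ^ 2) n).natDegree = n := by
    rw [scaledHermite_eq_hermite_comp hs.ne', natDegree_C_mul (by positivity), natDegree_comp,
      (hermite_monic n).natDegree_map, natDegree_C_mul_X _ hs.ne', natDegree_hermite, mul_one]
  refine ⟨?_, hd⟩
  rw [Monic, scaledHermite_eq_hermite_comp hs.ne', leadingCoeff_mul, leadingCoeff_C,
    leadingCoeff_comp (by rw [natDegree_C_mul_X _ hs.ne']; simp), leadingCoeff_C_mul_X,
    ((hermite_monic n).map _).leadingCoeff, (hermite_monic n).natDegree_map, natDegree_hermite,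
    one_mul, ← mul_pow, inv_mul_cancel₀ hs.ne', one_pow]

lemma integrable_eval_mul_gaussian {a : ℝ} (ha : 0 < a) (p : ℝ[X]) :
    Integrable fun x : ℝ => p.eval x * Real.exp (-a * x ^ 2 / 2) := by
  induction p using Polynomial.induction_on' with
  | add p q hp hq => simpa only [eval_add, add_mul] using! hp.add hq
  | monomial n c =>
    have h := (integrable_rpow_mul_exp_neg_mul_sq (b := a / 2) (by positivity) (s := n)
      (by linarith [(Nat.cast_nonneg n : (0 : ℝ) ≤ n)])).const_mul c
    refine h.congr (Filter.Eventually.of_forall fun x => ?_)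
    simp only [eval_monomial, Real.rpow_natCast, mul_assoc]
    congr 3
    ring

lemma integrable_pow_mul_eval_mul_gaussian {a : ℝ} (ha : 0 < a) (j : ℕ) (p : ℝ[X]) :
    Integrable fun x : ℝ => x ^ j * p.eval x * Real.exp (-a * x ^ 2 / 2) :=
  (integrable_eval_mul_gaussian ha (X ^ j * p)).congr <|
    Filter.Eventually.of_forall fun x => by simp only [eval_mul, eval_pow, eval_X]

lemma integral_mul_scaledHermite_succ {a : ℝ} (ha : 0 < a) (q : ℝ[X]) (n : ℕ) :
    ∫ x : ℝ, q.eval x * (scaledHermite a (n + 1)).eval x * Real.exp (-a * x ^ 2 / 2) =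
      a⁻¹ * ∫ x : ℝ, (derivative q).eval x * (scaledHermite a n).eval x *
        Real.exp (-a * x ^ 2 / 2) := by
  set Q := scaledHermite a n
  have hderiv (x : ℝ) : HasDerivAt (fun x => (q * Q).eval x * Real.exp (-a * x ^ 2 / 2))
      ((derivative (q * Q) - C a * X * (q * Q)).eval x * Real.exp (-a * x ^ 2 / 2)) x := by
    have h1 : HasDerivAt (fun x : ℝ => -a * x ^ 2 / 2) (-a * x) x := by
      convert! ((hasDerivAt_pow 2 x).const_mul (-a)).div_const 2 using 1
      norm_num; ring
    convert! ((q * Q).hasDerivAt x).mul h1.exp using 1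
    simp; ring
  have h0 := integral_eq_zero_of_hasDerivAt_of_integrable hderiv
    (integrable_eval_mul_gaussian ha _) (integrable_eval_mul_gaussian ha _)
  have key (x : ℝ) : q.eval x * (scaledHermite a (n + 1)).eval x * Real.exp (-a * x ^ 2 / 2) =
      a⁻¹ * ((derivative q * Q).eval x * Real.exp (-a * x ^ 2 / 2)) - a⁻¹ *
        ((derivative (q * Q) - C a * X * (q * Q)).eval x * Real.exp (-a * x ^ 2 / 2)) := by
    simp [scaledHermite, Q]
    field_simp
    ring
  simp_rw [key]
  rw [integral_sub ((integrable_eval_mul_gaussian ha _).const_mul _)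
    ((integrable_eval_mul_gaussian ha _).const_mul _), integral_const_mul, integral_const_mul, h0]
  simp

lemma integral_pow_mul_scaledHermite {a : ℝ} (ha : 0 < a) {j n : ℕ} (hj : j < n) :
    ∫ x : ℝ, x ^ j * (scaledHermite a n).eval x * Real.exp (-a * x ^ 2 / 2) = 0 := by
  induction n generalizing j with
  | zero => omega
  | succ n ih =>
    have h := integral_mul_scaledHermite_succ ha (X ^ j) n
    simp only [eval_pow, eval_X] at h
    rw [h]
    cases j with
    | zero => simp
    | succ j =>
      simp only [derivative_X_pow, eval_mul, eval_C, eval_pow, eval_X, mul_assoc,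
        integral_const_mul]
      have := ih (j := j) (by omega)
      simp only [mul_assoc] at this
      rw [Nat.add_sub_cancel, this, mul_zero, mul_zero]

lemma eq_zero_of_integral_pow_mul_eq_zero {a : ℝ} (ha : 0 < a) {n : ℕ} {D : ℝ[X]}
    (hD : D.degree < n)
    (h : ∀ j < n, ∫ x : ℝ, x ^ j * D.eval x * Real.exp (-a * x ^ 2 / 2) = 0) : D = 0 := by
  have hsq : ∫ x : ℝ, (D * D).eval x * Real.exp (-a * x ^ 2 / 2) = 0 := by
    have (x : ℝ) : (D * D).eval x * Real.exp (-a * x ^ 2 / 2) =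
        ∑ j ∈ range n, D.coeff j * (x ^ j * D.eval x * Real.exp (-a * x ^ 2 / 2)) := by
      rw [eval_mul]
      by_cases hD0 : D = 0
      · simp [hD0]
      nth_rw 1 [eval_eq_sum_range' ((natDegree_lt_iff_degree_lt hD0).2 hD)]
      rw [sum_mul, sum_mul]
      exact sum_congr rfl fun j _ => by ring
    simp_rw [this]
    rw [integral_finsetSum _ fun j _ => (integrable_pow_mul_eval_mul_gaussian ha j D).const_mul _]
    refine sum_eq_zero fun j hj => ?_
    rw [integral_const_mul, h j (mem_range.1 hj), mul_zero]
  have hcont : Continuous fun x : ℝ => (D * D).eval x * Real.exp (-a * x ^ 2 / 2) := by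
    fun_prop
  have hnonneg : 0 ≤ fun x : ℝ => (D * D).eval x * Real.exp (-a * x ^ 2 / 2) := fun x => by
    simp only [eval_mul, Pi.zero_apply]
    exact mul_nonneg (mul_self_nonneg _) (Real.exp_nonneg _)
  rw [integral_eq_zero_iff_of_nonneg hnonneg (integrable_eval_mul_gaussian ha _),
    hcont.ae_eq_iff_eq volume continuous_zero] at hsq
  refine Polynomial.funext fun x => ?_
  simpa [Real.exp_ne_zero] using congrFun hsq x

lemma IsMonicOrthogonal.eq_scaledHermite {a : ℝ} (ha : 0 < a) {n : ℕ} {P : ℝ[X]}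
    (hP : IsMonicOrthogonal (fun x => Real.exp (-a * x ^ 2 / 2)) n P) :
    P = scaledHermite a n := by
  obtain ⟨hm, hd, ho⟩ := hP
  obtain ⟨hQm, hQd⟩ := scaledHermite_monic_natDegree ha n
  refine sub_eq_zero.1 (eq_zero_of_integral_pow_mul_eq_zero ha (n := n) ?_ fun j hj => ?_)
  · have h := degree_sub_lt_left (by rw [degree_eq_natDegree hm.ne_zero,
      degree_eq_natDegree hQm.ne_zero, hd, hQd]) hm.ne_zero
      (by rw [hm, hQm] : P.leadingCoeff = (scaledHermite a n).leadingCoeff)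
    rwa [degree_eq_natDegree hm.ne_zero, hd] at h
  · simp only [eval_sub, mul_sub, sub_mul]
    rw [integral_sub (integrable_pow_mul_eval_mul_gaussian ha j _)
      (integrable_pow_mul_eval_mul_gaussian ha j _), ho j hj, integral_pow_mul_scaledHermite ha hj,
      sub_zero]

lemma aeval_scaledHermite {s : ℝ} (hs : s ≠ 0) (n : ℕ) (z : ℂ) :
    aeval z (scaledHermite (s ^ 2) n) =
      ∑ i ∈ range (n + 1), (s : ℂ)⁻¹ ^ n * ((hermite n).coeff i * (s * z) ^ i) := by
  rw [scaledHermite_eq_hermite_comp hs, map_mul, aeval_C, aeval_comp, map_mul, aeval_C, aeval_X,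
    aeval_def, eval₂_map, eval₂_eq_sum_range, natDegree_hermite, mul_sum]
  simp

section Involutions

variable {α : Type*} [Fintype α] [DecidableEq α]

lemma cycleType_eq_replicate_two_iff (σ : Equiv.Perm α) :
    (∃ k, σ.cycleType = Multiset.replicate k 2) ↔ ∀ i, σ (σ i) = i := by
  constructor
  · rintro ⟨k, hk⟩ i
    have h : orderOf σ ∣ 2 := by
      rw [← Equiv.Perm.lcm_cycleType, Multiset.lcm_dvd, hk]
      intro b hb
      rw [Multiset.eq_of_mem_replicate hb]
    have := orderOf_dvd_iff_pow_eq_one.1 h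
    rw [sq] at this
    exact congrArg (fun τ : Equiv.Perm α => τ i) this
  · intro h
    refine ⟨_, Multiset.eq_replicate.2 ⟨rfl, fun b hb => ?_⟩⟩
    have h2 : σ ^ 2 = 1 := by ext i; simp [sq, h]
    exact le_antisymm (Nat.le_of_dvd two_pos ((Equiv.Perm.dvd_of_mem_cycleType hb).trans
      (orderOf_dvd_of_pow_eq_one h2))) (Equiv.Perm.two_le_of_mem_cycleType hb)

lemma card_fixed_add_card_support (σ : Equiv.Perm α) :
    #{i | σ i = i} + #σ.support = Fintype.card α := by
  rw [← card_univ, ← card_filter_add_card_filter_not (s := univ) fun i => σ i = i]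
  rfl

lemma involutive_card_fixed_iff (σ : Equiv.Perm α) {k i : ℕ} (hN : Fintype.card α = 2 * k + i) :
    ((∀ j, σ (σ j) = j) ∧ #{j | σ j = j} = i) ↔ σ.cycleType = Multiset.replicate k 2 := by
  have hc := card_fixed_add_card_support σ
  rw [← cycleType_eq_replicate_two_iff, ← Equiv.Perm.sum_cycleType] at *
  constructor
  · rintro ⟨⟨l, hl⟩, hi⟩
    rw [hl] at hc ⊢
    simp at hc
    congr
    omega
  · intro h
    refine ⟨⟨k, h⟩, ?_⟩
    rw [h] at hc
    simp at hc
    omega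

lemma card_involutions_mul {k i : ℕ} (hN : Fintype.card α = 2 * k + i) :
    #{σ : Equiv.Perm α | (∀ j, σ (σ j) = j) ∧ #{j | σ j = j} = i} *
        (i.factorial * 2 ^ k * k.factorial)
      = (2 * k + i).factorial := by
  simp_rw [involutive_card_fixed_iff _ hN]
  have h := Equiv.Perm.card_of_cycleType_mul_eq (α := α) (Multiset.replicate k 2)
  rw [if_pos (by
    refine ⟨by simp; omega, fun a ha => (Multiset.eq_of_mem_replicate ha).ge⟩), hN] at h
  rw [← h]
  congr 2
  · congr 2
    · simp; omega
    · simp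
  · rcases Nat.eq_zero_or_pos k with rfl | hk
    · simp
    · rw [Multiset.toFinset_replicate, if_neg hk.ne']
      simp

lemma card_involutions_eq {k i : ℕ} (hN : Fintype.card α = 2 * k + i) :
    #{σ : Equiv.Perm α | (∀ j, σ (σ j) = j) ∧ #{j | σ j = j} = i}
      = (2 * k - 1).doubleFactorial * (2 * k + i).choose i := by
  have h := card_involutions_mul hN
  refine Nat.eq_of_mul_eq_mul_right (by positivity : 0 < i.factorial * 2 ^ k * k.factorial) ?_
  have h2 : (2 * k - 1).doubleFactorial * (2 ^ k * k.factorial) = (2 * k).factorial := by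
    rcases k with _ | k
    · simp
    · rw [← Nat.doubleFactorial_two_mul, show 2 * (k + 1) - 1 = 2 * k + 1 by omega, mul_comm,
        show 2 * (k + 1) = (2 * k + 1) + 1 by omega, ← Nat.factorial_eq_mul_doubleFactorial]
  rw [h]
  have h3 := Nat.add_choose_mul_factorial_mul_factorial (2 * k) i
  rw [← h3, ← h2]
  ring

lemma card_involutions_eq_zero {i : ℕ} (hN : ∀ k, Fintype.card α ≠ 2 * k + i) :
    #{σ : Equiv.Perm α | (∀ j, σ (σ j) = j) ∧ #{j | σ j = j} = i} = 0 := by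
  rw [card_eq_zero, filter_eq_empty_iff]
  rintro σ - ⟨h, hi⟩
  obtain ⟨k, hk⟩ := (cycleType_eq_replicate_two_iff σ).2 h
  have hc := card_fixed_add_card_support σ
  rw [← Equiv.Perm.sum_cycleType, hk, hi] at hc
  simp at hc
  exact hN k (by omega)

end Involutions

lemma two_mul_card_pairs {α : Type*} [Fintype α] [LinearOrder α] {σ : Equiv.Perm α}
    (h : ∀ i, σ (σ i) = i) :
    #{i | σ i = i} + 2 * #{p : {p : α × α // p.1 < p.2} | σ p.1.1 = p.1.2} = Fintype.card α := by
  have e1 : #{p : {p : α × α // p.1 < p.2} | σ p.1.1 = p.1.2} = #{i | i < σ i} := by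
    refine card_bij (fun p _ => p.1.1) ?_ ?_ ?_
    · rintro ⟨⟨i, j⟩, hij⟩ hp
      simp at hp ⊢
      rwa [hp]
    · rintro ⟨⟨i, j⟩, hij⟩ hp ⟨⟨i', j'⟩, hij'⟩ hp' e
      simp at hp hp' e ⊢
      subst e
      exact ⟨rfl, hp.symm.trans hp'⟩
    · intro i hi
      simp at hi
      exact ⟨⟨(i, σ i), hi⟩, by simp, rfl⟩
  have e2 : #{i | i < σ i} = #{i | σ i < i} := by
    refine card_bij (fun i _ => σ i) ?_ ?_ ?_
    · intro i hi
      simpa [h] using hi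
    · intro i _ j _ e
      exact σ.injective e
    · intro i hi
      exact ⟨σ i, by simpa [h] using hi, h i⟩
  have e3 : σ.support = univ.filter (fun i => i < σ i) ∪ univ.filter (fun i => σ i < i) := by
    ext i
    simp [lt_or_lt_iff_ne, eq_comm (a := i)]
  have hc := card_fixed_add_card_support σ
  rw [e3, card_union_of_disjoint (by
    rw [disjoint_filter]; intro i _ h1 h2; exact lt_asymm h1 h2)] at hc
  omega

@[to_additive]
lemma prod_subtype_lt {α β : Type*} [Fintype α] [LinearOrder α] [CommMonoid β] (h : α → α → β) :
    ∏ p : {p : α × α // p.1 < p.2}, h p.1.1 p.1.2 = ∏ i, ∏ j, if i < j then h i j else 1 := by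
  rw [← Fintype.prod_prod_type', ← prod_filter, prod_subtype (p := fun p : α × α => p.1 < p.2)]
  simp

lemma sum_sum_eq_diag_add_subtype_lt {α β : Type*} [Fintype α] [LinearOrder α] [AddCommMonoid β]
    (f : α → α → β) :
    ∑ i, ∑ j, f i j =
      ∑ i, f i i + ∑ p : {p : α × α // p.1 < p.2}, (f p.1.1 p.1.2 + f p.1.2 p.1.1) := by
  rw [sum_add_distrib, sum_subtype_lt f, sum_subtype_lt fun i j => f j i,
    sum_comm (f := fun i j => if i < j then f j i else 0), ← sum_add_distrib, ← sum_add_distrib]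
  refine sum_congr rfl fun i _ => ?_
  have : f i i = ∑ j, if j = i then f i j else 0 := by simp
  rw [this, ← sum_add_distrib, ← sum_add_distrib]
  refine sum_congr rfl fun j _ => ?_
  rcases lt_trichotomy i j with hij | rfl | hij
  · simp [hij, hij.ne', hij.not_gt]
  · simp
  · simp [hij, hij.ne, hij.not_gt]

lemma prod_perm_eq_diag_mul_subtype_lt {α β : Type*} [Fintype α] [LinearOrder α] [CommMonoid β]
    (G : α → α → β) (σ : Equiv.Perm α) :
    ∏ i, G i (σ i) = (∏ i, if σ i = i then G i i else 1) *
      ∏ p : {p : α × α // p.1 < p.2}, ((if σ p.1.1 = p.1.2 then G p.1.1 p.1.2 else 1) *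
        if σ p.1.2 = p.1.1 then G p.1.2 p.1.1 else 1) := by
  rw [prod_mul_distrib, prod_subtype_lt fun i j => if σ i = j then G i j else 1,
    prod_subtype_lt fun i j => if σ j = i then G j i else 1,
    prod_comm (f := fun i j => if i < j then if σ j = i then G j i else 1 else 1),
    ← prod_mul_distrib, ← prod_mul_distrib]
  refine prod_congr rfl fun i _ => ?_
  have h1 : (∏ j, if i < j then if σ i = j then G i j else 1 else 1) =
      if i < σ i then G i (σ i) else 1 := by
    rw [prod_eq_single (σ i) (by intro j _ hj; simp [hj.symm]) (by simp)]
    simp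
  have h2 : (∏ j, if j < i then if σ i = j then G i j else 1 else 1) =
      if σ i < i then G i (σ i) else 1 := by
    rw [prod_eq_single (σ i) (by intro j _ hj; simp [hj.symm]) (by simp)]
    simp
  rw [h1, h2]
  rcases lt_trichotomy i (σ i) with hij | hij | hij
  · simp [hij, hij.ne', hij.not_gt]
  · simp [← hij]
  · simp [hij, hij.ne, hij.not_gt]

lemma symOf_diag (N : ℕ) (x : (Fin N → ℝ) × ({p : Fin N × Fin N // p.1 < p.2} → ℝ)) (i : Fin N) :
    symOf N x i i = x.1 i := by
  simp [symOf]

lemma symOf_of_lt (N : ℕ) (x : (Fin N → ℝ) × ({p : Fin N × Fin N // p.1 < p.2} → ℝ))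
    (p : {p : Fin N × Fin N // p.1 < p.2}) : symOf N x p.1.1 p.1.2 = x.2 p := by
  simp [symOf, p.2]

lemma symOf_of_gt (N : ℕ) (x : (Fin N → ℝ) × ({p : Fin N × Fin N // p.1 < p.2} → ℝ))
    (p : {p : Fin N × Fin N // p.1 < p.2}) : symOf N x p.1.2 p.1.1 = x.2 p := by
  simp [symOf, p.2, p.2.not_gt]

lemma trace_symOf_sq (N : ℕ) (x : (Fin N → ℝ) × ({p : Fin N × Fin N // p.1 < p.2} → ℝ)) :
    trace (symOf N x ^ 2) = ∑ i, x.1 i ^ 2 + ∑ p, 2 * x.2 p ^ 2 := by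
  have : trace (symOf N x ^ 2) = ∑ i, ∑ j, symOf N x i j * symOf N x j i := by
    simp [sq, trace, mul_apply]
  rw [this, sum_sum_eq_diag_add_subtype_lt]
  simp only [symOf_diag, symOf_of_lt, symOf_of_gt]
  congr 1 <;> exact sum_congr rfl fun i _ => by ring

lemma card_add_two_mul_card_subtype_lt (N : ℕ) :
    N + 2 * Fintype.card {p : Fin N × Fin N // p.1 < p.2} = N * N := by
  have h := sum_sum_eq_diag_add_subtype_lt fun _ _ : Fin N => 1
  simp only [sum_const, card_univ, Fintype.card_fin, smul_eq_mul, mul_one] at h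
  omega

lemma goe_density_eq_prod_gaussianPDFReal {N : ℕ} (hN : 1 ≤ N)
    (x : (Fin N → ℝ) × ({p : Fin N × Fin N // p.1 < p.2} → ℝ)) :
    (2 : ℝ) ^ (-(N : ℝ) / 2) * ((N : ℝ) / Real.pi) ^ ((N : ℝ) * (N + 1) / 4) *
      Real.exp (-(N : ℝ) / 2 * trace (symOf N x ^ 2)) =
    (∏ i, ProbabilityTheory.gaussianPDFReal 0 (N : NNReal)⁻¹ (x.1 i)) *
      ∏ p, ProbabilityTheory.gaussianPDFReal 0 (2 * N : NNReal)⁻¹ (x.2 p) := by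
  have hN0 : (0 : ℝ) < N := by exact_mod_cast hN
  have hpi := Real.pi_pos
  simp only [ProbabilityTheory.gaussianPDFReal]
  rw [prod_mul_distrib, prod_mul_distrib, ← Real.exp_sum, ← Real.exp_sum, mul_mul_mul_comm,
    ← Real.exp_add]
  congr 1
  · simp only [prod_const, card_univ, Fintype.card_fin, NNReal.coe_inv, NNReal.coe_mul,
      NNReal.coe_natCast, NNReal.coe_ofNat]
    have hm := card_add_two_mul_card_subtype_lt N
    set m := Fintype.card {p : Fin N × Fin N // p.1 < p.2}
    have hmr : (N : ℝ) + 2 * m = N * N := by exact_mod_cast hm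
    have e1 : (√(2 * Real.pi * (N : ℝ)⁻¹))⁻¹ =
        (2 : ℝ) ^ (-(1 / 2) : ℝ) * (N / Real.pi) ^ (1 / 2 : ℝ) := by
      rw [Real.sqrt_eq_rpow, ← Real.rpow_neg (by positivity), mul_assoc,
        Real.mul_rpow (by positivity) (by positivity), ← div_eq_mul_inv, ← inv_div (N : ℝ),
        Real.inv_rpow (by positivity), ← Real.rpow_neg (by positivity), neg_neg]
    have e2 : (√(2 * Real.pi * (2 * (N : ℝ))⁻¹))⁻¹ = (N / Real.pi) ^ (1 / 2 : ℝ) := by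
      rw [Real.sqrt_eq_rpow, ← Real.inv_rpow (by positivity)]
      congr 1
      field_simp
    rw [e1, e2, mul_pow, ← Real.rpow_mul_natCast (by positivity),
      ← Real.rpow_mul_natCast (by positivity), ← Real.rpow_mul_natCast (by positivity), mul_assoc,
      ← Real.rpow_add (by positivity)]
    congr 2
    · ring
    · linear_combination (-1 / 4) * hmr
  · congr 1
    rw [trace_symOf_sq, mul_add, mul_sum, mul_sum]
    congr 1
    · refine sum_congr rfl fun i _ => ?_
      simp
      field_simp
    · refine sum_congr rfl fun i _ => ?_
      simp
      field_simp

section GaussianMoments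

open ProbabilityTheory

variable {v : NNReal}

lemma integrable_gaussianPDFReal_smul_iff (hv : v ≠ 0) {f : ℝ → ℂ} :
    Integrable (fun t => gaussianPDFReal 0 v t • f t) ↔ Integrable f (gaussianReal 0 v) := by
  rw [gaussianReal_of_var_ne_zero _ hv, integrable_withDensity_iff_integrable_smul'
    (measurable_gaussianPDF 0 v) (by simp [gaussianPDF])]
  simp only [toReal_gaussianPDF]

lemma integrable_ofReal_gaussianReal : Integrable (fun t : ℝ => (t : ℂ)) (gaussianReal 0 v) :=
  ((memLp_id_gaussianReal 1).integrable le_rfl).ofReal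

lemma integrable_ofReal_sq_gaussianReal :
    Integrable (fun t : ℝ => (t : ℂ) ^ 2) (gaussianReal 0 v) := by
  have : Integrable (fun t : ℝ => t ^ 2) (gaussianReal 0 v) :=
    (memLp_id_gaussianReal 2).integrable_sq
  exact_mod_cast this.ofReal (𝕜 := ℂ)

lemma integral_ofReal_gaussianReal : ∫ t : ℝ, (t : ℂ) ∂gaussianReal 0 v = 0 := by
  rw [integral_complex_ofReal, integral_id_gaussianReal, Complex.ofReal_zero]

lemma integral_ofReal_sq_gaussianReal : ∫ t : ℝ, (t : ℂ) ^ 2 ∂gaussianReal 0 v = v := by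
  have h := variance_fun_id_gaussianReal (μ := 0) (v := v)
  rw [variance_of_integral_eq_zero (by fun_prop) integral_id_gaussianReal] at h
  have h2 : ∫ t : ℝ, ((t ^ 2 : ℝ) : ℂ) ∂gaussianReal 0 v = ((v : ℝ) : ℂ) := by
    rw [integral_complex_ofReal, h]
  exact_mod_cast h2

end GaussianMoments

section Expectation

open ProbabilityTheory

lemma measurable_symOf (N : ℕ) : Measurable (symOf N) := by
  refine measurable_pi_lambda _ fun i => measurable_pi_lambda _ fun j => ?_
  simp only [symOf]
  split_ifs <;> fun_prop

lemma measurable_perm_sub {N : ℕ} (μ : ℂ) : Measurable fun H : Matrix (Fin N) (Fin N) ℝ =>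
    perm (μ • (1 : Matrix (Fin N) (Fin N) ℂ) - H.map Complex.ofReal) := by
  have hentry (i j : Fin N) : Measurable fun H : Matrix (Fin N) (Fin N) ℝ => H i j :=
    (measurable_pi_apply j).comp (measurable_pi_apply i)
  simp only [perm, Matrix.sub_apply, Matrix.map_apply]
  exact Finset.measurable_fun_sum _ fun σ _ => Finset.measurable_fun_prod _ fun i _ =>
    measurable_const.sub (Complex.measurable_ofReal.comp (hentry _ _))

lemma integral_goe {N : ℕ} (hN : 1 ≤ N) {f : Matrix (Fin N) (Fin N) ℝ → ℂ} (hf : Measurable f) :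
    ∫ H, f H ∂goe N = ∫ x, ((∏ i, gaussianPDFReal 0 (N : NNReal)⁻¹ (x.1 i)) *
      ∏ p, gaussianPDFReal 0 (2 * N : NNReal)⁻¹ (x.2 p)) • f (symOf N x) := by
  rw [goe, integral_map (measurable_symOf N).aemeasurable hf.aestronglyMeasurable]
  simp_rw [goe_density_eq_prod_gaussianPDFReal hN]
  rw [integral_withDensity_eq_integral_toReal_smul (by fun_prop) (by simp)]
  refine integral_congr_ae (Filter.Eventually.of_forall fun x => ?_)
  simp only
  rw [ENNReal.toReal_ofReal]
  exact mul_nonneg (prod_nonneg fun _ _ => gaussianPDFReal_nonneg _ _ _)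
    (prod_nonneg fun _ _ => gaussianPDFReal_nonneg _ _ _)

lemma smul_prod_mul_prod_gaussianPDFReal {ι κ : Type*} [Fintype ι] [Fintype κ] (v w : NNReal)
    (a : ι → ℝ → ℂ) (b : κ → ℝ → ℂ) (x : (ι → ℝ) × (κ → ℝ)) :
    ((∏ i, gaussianPDFReal 0 v (x.1 i)) * ∏ p, gaussianPDFReal 0 w (x.2 p)) •
      ((∏ i, a i (x.1 i)) * ∏ p, b p (x.2 p)) =
      (∏ i, gaussianPDFReal 0 v (x.1 i) • a i (x.1 i)) *
        ∏ p, gaussianPDFReal 0 w (x.2 p) • b p (x.2 p) := by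
  simp only [Complex.real_smul, Complex.ofReal_mul, Complex.ofReal_prod, prod_mul_distrib]
  ring

lemma integrable_gaussianPDFReal_prod {ι κ : Type*} [Fintype ι] [Fintype κ] {v w : NNReal}
    (hv : v ≠ 0) (hw : w ≠ 0) {a : ι → ℝ → ℂ} {b : κ → ℝ → ℂ}
    (ha : ∀ i, Integrable (a i) (gaussianReal 0 v))
    (hb : ∀ p, Integrable (b p) (gaussianReal 0 w)) :
    Integrable fun x : (ι → ℝ) × (κ → ℝ) =>
      ((∏ i, gaussianPDFReal 0 v (x.1 i)) * ∏ p, gaussianPDFReal 0 w (x.2 p)) •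
        ((∏ i, a i (x.1 i)) * ∏ p, b p (x.2 p)) := by
  simp_rw [smul_prod_mul_prod_gaussianPDFReal]
  exact (Integrable.fintype_prod (f := fun i t => gaussianPDFReal 0 v t • a i t)
      fun i => (integrable_gaussianPDFReal_smul_iff hv).2 (ha i)).mul_prod
    (Integrable.fintype_prod (f := fun i t => gaussianPDFReal 0 w t • b i t)
      fun p => (integrable_gaussianPDFReal_smul_iff hw).2 (hb p))

lemma integral_gaussianPDFReal_prod {ι κ : Type*} [Fintype ι] [Fintype κ] {v w : NNReal}
    (hv : v ≠ 0) (hw : w ≠ 0) (a : ι → ℝ → ℂ) (b : κ → ℝ → ℂ) :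
    ∫ x : (ι → ℝ) × (κ → ℝ),
      ((∏ i, gaussianPDFReal 0 v (x.1 i)) * ∏ p, gaussianPDFReal 0 w (x.2 p)) •
        ((∏ i, a i (x.1 i)) * ∏ p, b p (x.2 p)) =
      (∏ i, ∫ t, a i t ∂gaussianReal 0 v) * ∏ p, ∫ t, b p t ∂gaussianReal 0 w := by
  simp_rw [smul_prod_mul_prod_gaussianPDFReal, integral_gaussianReal_eq_integral_smul hv,
    integral_gaussianReal_eq_integral_smul hw]
  rw [Measure.volume_eq_prod,
    integral_prod_mul (fun y : ι → ℝ => ∏ i, gaussianPDFReal 0 v (y i) • a i (y i))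
      fun y : κ → ℝ => ∏ p, gaussianPDFReal 0 w (y p) • b p (y p),
    integral_fintype_prod_volume_eq_prod fun i t => gaussianPDFReal 0 v t • a i t,
    integral_fintype_prod_volume_eq_prod fun i t => gaussianPDFReal 0 w t • b i t]

lemma integrable_ite_sub_gaussianReal {v : NNReal} (P : Prop) [Decidable P] (μ : ℂ) :
    Integrable (fun t : ℝ => if P then μ - t else 1) (gaussianReal 0 v) := by
  split_ifs
  · exact (integrable_const μ).sub integrable_ofReal_gaussianReal
  · exact integrable_const 1

lemma integral_ite_sub_gaussianReal {v : NNReal} (P : Prop) [Decidable P] (μ : ℂ) :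
    ∫ t : ℝ, (if P then μ - t else 1) ∂gaussianReal 0 v = if P then μ else 1 := by
  split_ifs
  · rw [integral_sub (integrable_const μ) integrable_ofReal_gaussianReal,
      integral_ofReal_gaussianReal]
    simp
  · simp

lemma integrable_ite_mul_ite_gaussianReal {v : NNReal} (P Q : Prop) [Decidable P] [Decidable Q] :
    Integrable (fun t : ℝ => (if P then (-t : ℂ) else 1) * if Q then (-t : ℂ) else 1)
      (gaussianReal 0 v) := by
  split_ifs
  · simpa [sq] using integrable_ofReal_sq_gaussianReal (v := v)
  · simpa using integrable_ofReal_gaussianReal.neg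
  · simpa using integrable_ofReal_gaussianReal.neg
  · simp

lemma integral_ite_mul_ite_gaussianReal {v : NNReal} (P Q : Prop) [Decidable P] [Decidable Q] :
    ∫ t : ℝ, (if P then (-t : ℂ) else 1) * (if Q then (-t : ℂ) else 1) ∂gaussianReal 0 v =
      if P ↔ Q then (if P then (v : ℂ) else 1) else 0 := by
  by_cases hP : P <;> by_cases hQ : Q
  · simpa [hP, hQ, sq] using integral_ofReal_sq_gaussianReal (v := v)
  · simp [hP, hQ, integral_neg, integral_ofReal_gaussianReal]
  · simp [hP, hQ, integral_neg, integral_ofReal_gaussianReal]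
  · simp [hP, hQ]

lemma prod_perm_sub_symOf {N : ℕ} (μ : ℂ) (σ : Equiv.Perm (Fin N))
    (x : (Fin N → ℝ) × ({p : Fin N × Fin N // p.1 < p.2} → ℝ)) :
    ∏ i, (μ • (1 : Matrix (Fin N) (Fin N) ℂ) - (symOf N x).map Complex.ofReal) i (σ i) =
      (∏ i, if σ i = i then μ - x.1 i else 1) *
        ∏ p : {p : Fin N × Fin N // p.1 < p.2}, ((if σ p.1.1 = p.1.2 then (-x.2 p : ℂ) else 1) *
          if σ p.1.2 = p.1.1 then (-x.2 p : ℂ) else 1) := by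
  rw [prod_perm_eq_diag_mul_subtype_lt
    (fun i j => (μ • (1 : Matrix (Fin N) (Fin N) ℂ) - (symOf N x).map Complex.ofReal) i j) σ]
  simp only [Matrix.sub_apply, Matrix.smul_apply, Matrix.map_apply, symOf_diag, symOf_of_lt,
    symOf_of_gt, one_apply_eq, smul_eq_mul, mul_one]
  congr 1
  refine prod_congr rfl fun p _ => ?_
  rw [one_apply_ne p.2.ne, one_apply_ne p.2.ne']
  simp

lemma prod_ite_subtype_lt {α : Type*} [Fintype α] [LinearOrder α] (σ : Equiv.Perm α) (c : ℂ) :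
    (∏ p : {p : α × α // p.1 < p.2},
      if σ p.1.1 = p.1.2 ↔ σ p.1.2 = p.1.1 then (if σ p.1.1 = p.1.2 then c else 1) else 0) =
    if ∀ i, σ (σ i) = i then c ^ ((Fintype.card α - #{i | σ i = i}) / 2) else 0 := by
  split_ifs with h
  · have hiff (p : {p : α × α // p.1 < p.2}) : σ p.1.1 = p.1.2 ↔ σ p.1.2 = p.1.1 :=
      ⟨fun e => by rw [← e, h], fun e => by rw [← e, h]⟩
    simp only [hiff, iff_self, if_true]
    simp only [← hiff]
    rw [prod_ite, prod_const, prod_const_one, mul_one]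
    congr 1
    have := two_mul_card_pairs h
    omega
  · push Not at h
    obtain ⟨i, hi⟩ := h
    have hne : i ≠ σ i := fun e => hi (by rw [← e, ← e])
    rcases hne.lt_or_gt with hlt | hlt
    · refine prod_eq_zero (mem_univ ⟨(i, σ i), hlt⟩) ?_
      simp [hi]
    · refine prod_eq_zero (mem_univ ⟨(σ i, i), hlt⟩) ?_
      simp [hi]

lemma integral_perm_goe {N : ℕ} (hN : 1 ≤ N) (μ : ℂ) :
    ∫ H, perm (μ • (1 : Matrix (Fin N) (Fin N) ℂ) - H.map Complex.ofReal) ∂goe N =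
      ∑ σ : Equiv.Perm (Fin N), if ∀ i, σ (σ i) = i then
        μ ^ #{i | σ i = i} * ((2 * N : ℂ)⁻¹) ^ ((N - #{i | σ i = i}) / 2) else 0 := by
  have hv : (N : NNReal)⁻¹ ≠ 0 := inv_ne_zero (by exact_mod_cast (by omega : N ≠ 0))
  have hw : (2 * N : NNReal)⁻¹ ≠ 0 := inv_ne_zero (by exact_mod_cast (by omega : 2 * N ≠ 0))
  rw [integral_goe hN (measurable_perm_sub μ)]
  simp_rw [perm, prod_perm_sub_symOf, smul_sum]
  rw [integral_finsetSum]
  · refine sum_congr rfl fun σ _ => ?_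
    rw [integral_gaussianPDFReal_prod hv hw (fun i t => if σ i = i then μ - t else 1)
      fun (p : {p : Fin N × Fin N // p.1 < p.2}) t =>
        (if σ p.1.1 = p.1.2 then (-t : ℂ) else 1) * if σ p.1.2 = p.1.1 then (-t : ℂ) else 1]
    simp_rw [integral_ite_sub_gaussianReal, integral_ite_mul_ite_gaussianReal]
    rw [prod_ite_subtype_lt, prod_ite, prod_const, prod_const_one, mul_one, mul_ite, mul_zero,
      Fintype.card_fin]
    simp
  · exact fun σ _ => integrable_gaussianPDFReal_prod hv hw
      (a := fun i t => if σ i = i then μ - t else 1)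
      (b := fun (p : {p : Fin N × Fin N // p.1 < p.2}) t =>
        (if σ p.1.1 = p.1.2 then (-t : ℂ) else 1) * if σ p.1.2 = p.1.1 then (-t : ℂ) else 1)
      (fun i => integrable_ite_sub_gaussianReal (σ i = i) μ)
      fun p => integrable_ite_mul_ite_gaussianReal (σ p.1.1 = p.1.2) (σ p.1.2 = p.1.1)

end Expectation

lemma sum_involutions_eq {N : ℕ} (μ c : ℂ) :
    (∑ σ : Equiv.Perm (Fin N), if ∀ i, σ (σ i) = i then
        μ ^ #{i | σ i = i} * c ^ ((N - #{i | σ i = i}) / 2) else 0) =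
      ∑ i ∈ range (N + 1),
        (#{σ : Equiv.Perm (Fin N) | (∀ j, σ (σ j) = j) ∧ #{j | σ j = j} = i} : ℂ) *
          (μ ^ i * c ^ ((N - i) / 2)) := by
  rw [← sum_filter, ← sum_fiberwise_of_maps_to (t := range (N + 1))
    (g := fun σ : Equiv.Perm (Fin N) => #{i | σ i = i})]
  · refine sum_congr rfl fun i _ => ?_
    rw [filter_filter, ← nsmul_eq_mul, ← sum_const]
    refine sum_congr rfl fun σ hσ => ?_
    rw [(mem_filter.1 hσ).2.2]
  · intro σ _
    simpa [Nat.lt_succ_iff] using card_le_univ (univ.filter fun i => σ i = i)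

/-- The expected GOE permanental polynomial in terms of the monic orthogonal (Hermite)
polynomial `π_N` for the weight `e^{-Nx²/2}`:
`⟨Per(μ·1 - H)⟩_GOE = (i^N / 2^{N/2}) π_N(-i√2 μ)`. -/
theorem goe_expected_permanental_polynomial (N : ℕ) (hN : 1 ≤ N)
    (P : Polynomial ℝ)
    (hP : IsMonicOrthogonal (fun x => Real.exp (-(N : ℝ) * x ^ 2 / 2)) N P)
    (μ : ℂ) :
    (∫ H, perm (μ • (1 : Matrix (Fin N) (Fin N) ℂ) - H.map (Complex.ofReal)) ∂(goe N))
      = (Complex.I ^ N / (2 : ℂ) ^ ((N : ℂ) / 2)) *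
        Polynomial.aeval (-Complex.I * (Real.sqrt 2 : ℂ) * μ) P := by
  have hN0 : (0 : ℝ) < N := by exact_mod_cast hN
  set s := √(N : ℝ)
  have hs : s ≠ 0 := (Real.sqrt_pos.2 hN0).ne'
  have hsN : s ^ 2 = N := Real.sq_sqrt hN0.le
  rw [hP.eq_scaledHermite hN0, ← hsN, aeval_scaledHermite hs, integral_perm_goe hN,
    sum_involutions_eq, mul_sum]
  have hsC : (s : ℂ) ≠ 0 := Complex.ofReal_ne_zero.2 hs
  have hsNC : (N : ℂ) = (s : ℂ) ^ 2 := by exact_mod_cast hsN.symm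
  set r : ℂ := ((√2 : ℝ) : ℂ)
  have hr2 : r ^ 2 = 2 := by
    simp only [r]
    exact_mod_cast Real.sq_sqrt (zero_le_two (α := ℝ))
  have hr : r ≠ 0 := by
    rintro h
    simp [h] at hr2
  have hpow : (2 : ℂ) ^ ((N : ℂ) / 2) = r ^ N := by
    have h1 : r = (2 : ℂ) ^ (1 / 2 : ℂ) := by
      simp only [r, Real.sqrt_eq_rpow]
      rw [Complex.ofReal_cpow zero_le_two]
      norm_num
    rw [h1, ← Complex.cpow_nat_mul]
    congr 1
    ring
  rw [hpow]
  refine sum_congr rfl fun i hi => ?_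
  have hiN : i ≤ N := by simpa [Nat.lt_succ_iff] using hi
  by_cases hk : ∃ k, N = 2 * k + i
  · obtain ⟨k, hk⟩ := hk
    have hcard : #{σ : Equiv.Perm (Fin N) | (∀ j, σ (σ j) = j) ∧ #{j | σ j = j} = i} =
        (2 * k - 1).doubleFactorial * (2 * k + i).choose i := by
      convert! card_involutions_eq (α := Fin N) (k := k) (by rwa [Fintype.card_fin])
    have hcoeff : (hermite N).coeff i =
        (-1) ^ k * ((2 * k - 1).doubleFactorial : ℤ) * ((2 * k + i).choose i : ℤ) := by
      rw [hk, coeff_hermite_explicit]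
    have hdiv : (N - i) / 2 = k := by omega
    have hI : Complex.I ^ N * (-Complex.I) ^ i = (-1) ^ k := by
      rw [hk, pow_add, mul_assoc, ← mul_pow, pow_mul, Complex.I_sq]
      simp
    have hsr : r ^ N * s ^ N = (2 * N : ℂ) ^ k * (r ^ i * s ^ i) := by
      rw [hsNC, ← hr2, hk]
      ring
    have hsq : (-1 : ℂ) ^ k * (-1) ^ k = 1 := by rw [← mul_pow]; simp
    have hNC : (2 * N : ℂ) ^ k ≠ 0 := pow_ne_zero _ (by rw [hsNC]; simp [hsC])
    have hratio : (r ^ N)⁻¹ * (s ^ N : ℂ)⁻¹ * (r ^ i * s ^ i) = ((2 * N : ℂ) ^ k)⁻¹ := by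
      rw [← mul_inv, hsr]
      field_simp
    rw [hcard, hcoeff, hdiv, inv_pow, inv_pow, ← hratio, mul_pow, mul_pow, mul_pow, div_eq_mul_inv]
    push_cast
    set d : ℂ := ((2 * k - 1).doubleFactorial : ℂ)
    set b : ℂ := ((2 * k + i).choose i : ℂ)
    linear_combination
      -(d * b * μ ^ i * (r ^ N)⁻¹ * (s ^ N : ℂ)⁻¹ * (r ^ i * s ^ i)) * ((-1) ^ k * hI + hsq)
  · have hk' : ∀ k, N ≠ 2 * k + i := fun k h => hk ⟨k, h⟩
    have hcard : #{σ : Equiv.Perm (Fin N) | (∀ j, σ (σ j) = j) ∧ #{j | σ j = j} = i} = 0 := by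
      convert! card_involutions_eq_zero (α := Fin N) (by simpa using hk')
    rw [hcard, coeff_hermite_of_odd_add]
    · simp
    · by_contra h
      rw [Nat.not_odd_iff_even] at h
      obtain ⟨m, hm⟩ := h
      exact hk' (m - i) (by omega)
end
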